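/- arXiv:2003.13134 — 3 statements merged into one kernel-verified Lean document; each statement's English description precedes it below -/
import Mathlib

section
/- If X is a suborderable Hausdorff space, then the quotient space C[X] of connected components of X is a strongly zero-dimensional suborderable space and the quotient map C : X → C[X] is a closed map. Moreover, if X is metrizable then C[X] is metrizable. -/
open Topology

/-- A Hausdorff space is suborderable (Čech) if it admits a linear order whose
open-interval topology is coarser than its topology and which has a base of
order-convex open sets. -/
def Suborderable (X : Type*) [TopologicalSpace X] : Prop :=
  ∃ l : LinearOrder X,
    (∀ a : X, IsOpen {x | l.lt x a}) ∧ (∀ a : X, IsOpen {x | l.lt a x}) ∧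
    (∀ (x : X) (U : Set X), IsOpen U → x ∈ U →
      ∃ V : Set X, IsOpen V ∧ x ∈ V ∧ V ⊆ U ∧
        ∀ a ∈ V, ∀ b ∈ V, ∀ c : X, l.le a c → l.le c b → c ∈ V)

/-- A space is strongly zero-dimensional (covering dimension `≤ 0`): every
finite open cover has a finite refinement by pairwise disjoint open sets. -/
def StronglyZeroDimensional (X : Type*) [TopologicalSpace X] : Prop :=
  ∀ 𝒰 : Set (Set X), 𝒰.Finite → (∀ U ∈ 𝒰, IsOpen U) → ⋃₀ 𝒰 = Set.univ →
    ∃ 𝒱 : Set (Set X), 𝒱.Finite ∧ (∀ V ∈ 𝒱, IsOpen V) ∧ ⋃₀ 𝒱 = Set.univ ∧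
      (∀ V ∈ 𝒱, ∃ U ∈ 𝒰, V ⊆ U) ∧
      ∀ V ∈ 𝒱, ∀ W ∈ 𝒱, V ≠ W → V ∩ W = ∅

open Set

/-- A linear order compatible with a topology: open rays are open, and there is a base of
order-convex open sets. -/
class CompatibleOrder (X : Type*) [TopologicalSpace X] [LinearOrder X] : Prop where
  isOpen_Iio' : ∀ a : X, IsOpen (Iio a)
  isOpen_Ioi' : ∀ a : X, IsOpen (Ioi a)
  exists_ordConnected : ∀ (x : X) (U : Set X), IsOpen U → x ∈ U →
    ∃ V : Set X, IsOpen V ∧ x ∈ V ∧ V ⊆ U ∧ V.OrdConnected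

namespace CompatibleOrder

section Basic

variable {X : Type*} [TopologicalSpace X] [LinearOrder X] [CompatibleOrder X]

instance : OrderClosedTopology X where
  isClosed_le' := by
    rw [← isOpen_compl_iff, isOpen_prod_iff]
    intro a b hab
    have hab : b < a := not_le.1 hab
    by_cases h : ∃ c, b < c ∧ c < a
    · obtain ⟨c, hbc, hca⟩ := h
      refine ⟨Ioi c, Iio c, isOpen_Ioi' c, isOpen_Iio' c, hca, hbc, ?_⟩
      rintro ⟨x, y⟩ ⟨hx, hy⟩
      exact not_le.2 (lt_trans hy hx)
    · refine ⟨Ioi b, Iio a, isOpen_Ioi' b, isOpen_Iio' a, hab, hab, ?_⟩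
      rintro ⟨x, y⟩ ⟨hx, hy⟩ hxy
      exact h ⟨x, hx, lt_of_le_of_lt hxy hy⟩

instance : CompatibleOrder Xᵒᵈ where
  isOpen_Iio' a := isOpen_Ioi' (X := X) (OrderDual.ofDual a)
  isOpen_Ioi' a := isOpen_Iio' (X := X) (OrderDual.ofDual a)
  exists_ordConnected x U hU hx := by
    obtain ⟨V, hV, hxV, hVU, hc⟩ :=
      exists_ordConnected (X := X) (OrderDual.ofDual x) (OrderDual.toDual ⁻¹' U) hU hx
    exact ⟨OrderDual.ofDual ⁻¹' V, hV, hxV, hVU, hc.dual⟩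

theorem ordConnected_connectedComponent (x : X) : (connectedComponent x).OrdConnected :=
  isPreconnected_connectedComponent.ordConnected

theorem isOpen_ordConnectedComponent {U : Set X} (hU : IsOpen U) (x : X) :
    IsOpen (ordConnectedComponent U x) := by
  rw [isOpen_iff_forall_mem_open]
  intro y hy
  obtain ⟨V, hV, hyV, hVU, hc⟩ := exists_ordConnected y U hU (ordConnectedComponent_subset hy)
  exact ⟨V, fun z hz => mem_ordConnectedComponent_trans hy
    (subset_ordConnectedComponent hyV hVU hz), hV, hyV⟩

/-- A component meeting the order-convex set `V` above `x ∈ V` and reaching outside `V` above `x`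
is determined by these properties. -/
theorem connectedComponent_eq_of_not_mem {V : Set X} (hV : V.OrdConnected) {x y z y' z' : X}
    (hx : x ∈ V) (hy : y ∈ V) (hy' : y' ∈ V) (hz : z ∉ V) (hz' : z' ∉ V)
    (hxz : x < z) (hxz' : x < z')
    (h : z ∈ connectedComponent y) (h' : z' ∈ connectedComponent y') :
    connectedComponent y = connectedComponent y' := by
  have above : ∀ w ∈ V, ∀ u, x < u → u ∉ V → w < u := fun w hw u hu huV =>
    not_le.1 fun h => huV (hV.out hx hw ⟨hu.le, h⟩)
  rcases le_total y y' with hyy | hyy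
  · exact connectedComponent_eq ((ordConnected_connectedComponent y).out mem_connectedComponent h
      ⟨hyy, (above y' hy' z hxz hz).le⟩)
  · exact (connectedComponent_eq ((ordConnected_connectedComponent y').out mem_connectedComponent h'
      ⟨hyy, (above y hy z' hxz' hz').le⟩)).symm

theorem exists_isOpen_forall_gt {F : Set X} (hF : IsClosed F) {x : X}
    (hx : Disjoint (connectedComponent x) F) :
    ∃ W : Set X, IsOpen W ∧ x ∈ W ∧ ∀ y ∈ W, x < y → Disjoint (connectedComponent y) F := by
  obtain ⟨V, hV, hxV, hVF, hc⟩ := exists_ordConnected x Fᶜ hF.isOpen_compl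
    (fun h => hx.le_bot ⟨mem_connectedComponent, h⟩)
  by_cases hall : ∀ y ∈ V, x < y → Disjoint (connectedComponent y) F
  · exact ⟨V, hV, hxV, hall⟩
  have key : ∀ y ∈ V, x < y → ¬ Disjoint (connectedComponent y) F →
      ∃ z ∉ V, x < z ∧ z ∈ connectedComponent y := by
    intro y hy hxy hd
    obtain ⟨z, hzy, hzF⟩ := not_disjoint_iff.1 hd
    refine ⟨z, fun h => hVF h hzF, not_le.1 fun hzx => hd ?_, hzy⟩
    rw [← connectedComponent_eq
      ((ordConnected_connectedComponent y).out hzy mem_connectedComponent ⟨hzx, hxy.le⟩)] at hx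
    exact hx
  push Not at hall
  obtain ⟨y, hy, hxy, hd⟩ := hall
  obtain ⟨z, hz, hxz, hzy⟩ := key y hy hxy hd
  refine ⟨V ∩ (connectedComponent y)ᶜ, hV.inter isClosed_connectedComponent.isOpen_compl,
    ⟨hxV, fun h => hd (connectedComponent_eq h ▸ hx)⟩, ?_⟩
  rintro y' ⟨hy', hny⟩ hxy'
  by_contra hd'
  obtain ⟨z', hz', hxz', hzy'⟩ := key y' hy' hxy' hd'
  apply hny
  rw [connectedComponent_eq_of_not_mem hc hxV hy hy' hz hz' hxz hxz' hzy hzy']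
  exact mem_connectedComponent

theorem isClosedMap_connectedComponents :
    IsClosedMap (ConnectedComponents.mk : X → ConnectedComponents X) := by
  intro F hF
  rw [← ConnectedComponents.isQuotientMap_coe.isClosed_preimage, ← isOpen_compl_iff,
    isOpen_iff_forall_mem_open]
  have iff_disj : ∀ x : X, x ∈ ((↑) ⁻¹' ((↑) '' F : Set (ConnectedComponents X)) : Set X)ᶜ ↔
      Disjoint (connectedComponent x) F := by
    intro x
    simp only [mem_compl_iff, mem_preimage, mem_image, not_exists, not_and,
      Set.disjoint_right]
    refine forall₂_congr fun z _ => not_congr ?_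
    rw [ConnectedComponents.coe_eq_coe, eq_comm, connectedComponent_eq_iff_mem]
    exact ⟨fun h => connectedComponent_eq h ▸ mem_connectedComponent,
      fun h => connectedComponent_eq h ▸ mem_connectedComponent⟩
  intro x hx
  rw [iff_disj] at hx
  obtain ⟨W, hW, hxW, hgt⟩ := exists_isOpen_forall_gt hF hx
  obtain ⟨W', hW', hxW', hlt⟩ := exists_isOpen_forall_gt (X := Xᵒᵈ) hF hx
  refine ⟨W ∩ W', ?_, hW.inter hW', hxW, hxW'⟩
  rintro y ⟨hy, hy'⟩
  rw [iff_disj]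
  rcases lt_trichotomy x y with h | rfl | h
  · exact hgt y hy h
  · exact hx
  · exact hlt y hy' h

/-- Points of distinct components are separated by a clopen initial segment. -/
theorem exists_isClopen_isLowerSet {a b : X} (hab : a < b) (hb : b ∉ connectedComponent a) :
    ∃ J : Set X, IsClopen J ∧ IsLowerSet J ∧ a ∈ J ∧ b ∉ J := by
  have hnc : ¬ IsPreconnected (Icc a b) := fun h =>
    hb (h.subset_connectedComponent (left_mem_Icc.2 hab.le) (right_mem_Icc.2 hab.le))
  simp only [IsPreconnected, not_forall] at hnc
  obtain ⟨u, v, hu, hv, huv, ⟨p, hp, hpu⟩, ⟨q, hq, hqv⟩, hne⟩ := hnc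
  wlog hpq : p ≤ q generalizing u v p q
  · exact this v u hv hu (by rwa [union_comm]) q hq hqv (by rwa [inter_comm v u])
      p hp hpu (le_of_not_ge hpq)
  have hdisj : ∀ z ∈ Icc a b, z ∈ u → z ∉ v := fun z hz hzu hzv => hne ⟨z, hz, hzu, hzv⟩
  have hpq : p < q := lt_of_le_of_ne hpq fun h => hdisj p hp hpu (h ▸ hqv)
  refine ⟨{z | Icc p z ⊆ u}, ⟨?_, ?_⟩, ?_, ?_, ?_⟩
  · rw [← isOpen_compl_iff, isOpen_iff_forall_mem_open]
    intro z hz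
    obtain ⟨w, hw, hwu⟩ := not_subset.1 hz
    rcases hw.2.lt_or_eq with hwz | rfl
    · exact ⟨Ioi w, fun y hy h => hwu (h ⟨hw.1, le_of_lt hy⟩), isOpen_Ioi' w, hwz⟩
    rcases le_or_gt w b with hwb | hbw
    · have hwv : w ∈ v := (huv ⟨hp.1.trans hw.1, hwb⟩).resolve_left hwu
      obtain ⟨V, hV, hwV, hVv, hc⟩ := exists_ordConnected w v hv hwv
      have hpw : p < w := lt_of_le_of_ne hw.1 fun h => hwu (h ▸ hpu)
      refine ⟨V ∩ Ioi p, ?_, hV.inter (isOpen_Ioi' p), hwV, hpw⟩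
      rintro y ⟨hyV, hpy⟩ hy
      rcases le_total w y with hwy | hyw
      · exact hwu (hy ⟨hw.1, hwy⟩)
      · exact hdisj y ⟨hp.1.trans (le_of_lt hpy), hyw.trans hwb⟩
          (hy ⟨le_of_lt hpy, le_rfl⟩) (hVv hyV)
    · exact ⟨Ioi b, fun y hy h => hdisj q hq (h ⟨hpq.le, hq.2.trans (le_of_lt hy)⟩) hqv,
        isOpen_Ioi' b, hbw⟩
  · rw [isOpen_iff_forall_mem_open]
    intro z hz
    rcases lt_or_ge z p with hzp | hpz
    · exact ⟨Iio p, fun y hy => by simp [Icc_eq_empty_of_lt (show y < p from hy)],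
        isOpen_Iio' p, hzp⟩
    · obtain ⟨V, hV, hzV, hVu, hc⟩ := exists_ordConnected z u hu (hz ⟨hpz, le_rfl⟩)
      refine ⟨V, fun y hy w hw => ?_, hV, hzV⟩
      rcases le_total w z with hwz | hzw
      · exact hz ⟨hw.1, hwz⟩
      · exact hVu (hc.out hzV hy ⟨hzw, hw.2⟩)
  · exact fun z w hwz hz => (Icc_subset_Icc_right hwz).trans hz
  · intro w hw
    rw [show w = p from le_antisymm (hw.2.trans hp.1) hw.1]
    exact hpu
  · exact fun h => hdisj q hq (h ⟨hpq.le, hq.2⟩) hqv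

end Basic

section Quotient

variable {X : Type*} [TopologicalSpace X] [LinearOrder X]

/-- The order on the space of components induced by comparing representatives. -/
noncomputable instance : LinearOrder (ConnectedComponents X) :=
  LinearOrder.lift' (Function.surjInv ConnectedComponents.surjective_coe)
    (Function.injective_surjInv _)

variable [CompatibleOrder X]

theorem coe_lt_coe_of_lt {x y : X} (hxy : x < y)
    (hne : (x : ConnectedComponents X) ≠ y) : (x : ConnectedComponents X) < y := by
  by_contra hlt
  set x' : X := Function.surjInv ConnectedComponents.surjective_coe (x : ConnectedComponents X)
  set y' : X := Function.surjInv ConnectedComponents.surjective_coe (y : ConnectedComponents X)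
  have hx : x' ∈ connectedComponent x :=
    ConnectedComponents.coe_eq_coe'.1 (Function.surjInv_eq ConnectedComponents.surjective_coe _)
  have hy : y' ∈ connectedComponent y :=
    ConnectedComponents.coe_eq_coe'.1 (Function.surjInv_eq ConnectedComponents.surjective_coe _)
  have hle : y' ≤ x' := not_lt.1 hlt
  have hmem : x ∉ connectedComponent y := fun h => hne (ConnectedComponents.coe_eq_coe'.2 h)
  have hmem' : x' ∉ connectedComponent y := fun h =>
    hmem (connectedComponent_eq_iff_mem.1
      ((connectedComponent_eq hx).trans (connectedComponent_eq h).symm))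
  rcases le_total y' x with h | h
  · exact hmem ((ordConnected_connectedComponent y).out hy mem_connectedComponent ⟨h, hxy.le⟩)
  · have : y' ∈ connectedComponent x :=
      (ordConnected_connectedComponent x).out mem_connectedComponent hx ⟨h, hle⟩
    exact hmem (connectedComponent_eq_iff_mem.1
      ((connectedComponent_eq this).trans (connectedComponent_eq hy).symm))

theorem monotone_coe : Monotone ((↑) : X → ConnectedComponents X) := by
  intro x y hxy
  rcases eq_or_ne (x : ConnectedComponents X) y with h | h
  · exact h.le
  · exact (coe_lt_coe_of_lt (lt_of_le_of_ne hxy fun e => h (e ▸ rfl)) h).le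

theorem coe_lt_coe_iff {x y : X} :
    (x : ConnectedComponents X) < y ↔ x < y ∧ x ∉ connectedComponent y := by
  rw [← ConnectedComponents.coe_eq_coe']
  exact ⟨fun h => ⟨monotone_coe.reflect_lt h, h.ne⟩, fun h => coe_lt_coe_of_lt h.1 h.2⟩

theorem preimage_ordConnectedComponent (W : Set (ConnectedComponents X)) (x : X) :
    ((↑) : X → ConnectedComponents X) ⁻¹' ordConnectedComponent W x =
      ordConnectedComponent ((↑) ⁻¹' W) x := by
  ext y
  simp only [mem_preimage, mem_ordConnectedComponent]
  refine ⟨fun h z hz => h (monotone_coe.mapsTo_uIcc hz), fun h M hM => ?_⟩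
  obtain ⟨m, rfl⟩ := ConnectedComponents.surjective_coe M
  have hx : (x : ConnectedComponents X) ∈ W := h left_mem_uIcc
  have hy : (y : ConnectedComponents X) ∈ W := h right_mem_uIcc
  by_cases hm : m ∈ uIcc x y
  · exact h hm
  rw [mem_uIcc] at hm hM
  by_cases hmx : (m : ConnectedComponents X) = x
  · exact hmx ▸ hx
  by_cases hmy : (m : ConnectedComponents X) = y
  · exact hmy ▸ hy
  exfalso
  rcases hM with ⟨h1, h2⟩ | ⟨h1, h2⟩
  · exact hm (Or.inl ⟨(monotone_coe.reflect_lt (lt_of_le_of_ne h1 (Ne.symm hmx))).le,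
      (monotone_coe.reflect_lt (lt_of_le_of_ne h2 hmy)).le⟩)
  · exact hm (Or.inr ⟨(monotone_coe.reflect_lt (lt_of_le_of_ne h1 (Ne.symm hmy))).le,
      (monotone_coe.reflect_lt (lt_of_le_of_ne h2 hmx)).le⟩)

instance : CompatibleOrder (ConnectedComponents X) where
  isOpen_Iio' a := by
    obtain ⟨a, rfl⟩ := ConnectedComponents.surjective_coe a
    rw [← ConnectedComponents.isQuotientMap_coe.isOpen_preimage]
    convert (isOpen_Iio' a).inter (isClosed_connectedComponent (x := a)).isOpen_compl using 1
    ext x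
    exact coe_lt_coe_iff
  isOpen_Ioi' a := by
    obtain ⟨a, rfl⟩ := ConnectedComponents.surjective_coe a
    rw [← ConnectedComponents.isQuotientMap_coe.isOpen_preimage]
    convert (isOpen_Ioi' a).inter (isClosed_connectedComponent (x := a)).isOpen_compl using 1
    ext x
    refine coe_lt_coe_iff.trans (and_congr Iff.rfl (not_congr ?_))
    rw [← connectedComponent_eq_iff_mem, eq_comm, connectedComponent_eq_iff_mem]
  exists_ordConnected z W hW hz := by
    obtain ⟨x, rfl⟩ := ConnectedComponents.surjective_coe z
    refine ⟨ordConnectedComponent W x, ?_, self_mem_ordConnectedComponent.2 hz,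
      ordConnectedComponent_subset, inferInstance⟩
    rw [← ConnectedComponents.isQuotientMap_coe.isOpen_preimage, preimage_ordConnectedComponent]
    exact isOpen_ordConnectedComponent (hW.preimage ConnectedComponents.continuous_coe) x

end Quotient

/-- A family of clopen sets, only finitely many of which split a suitable neighbourhood of any
given point. -/
structure LocallyFiniteClopen {X : Type*} [TopologicalSpace X] (𝒥 : Set (Set X)) : Prop where
  isClopen : ∀ J ∈ 𝒥, IsClopen J
  finite : ∀ z, ∃ V ∈ 𝓝 z, {J ∈ 𝒥 | ∃ v ∈ V, ∃ w ∈ V, v ∈ J ∧ w ∉ J}.Finite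

theorem LocallyFiniteClopen.union {X : Type*} [TopologicalSpace X] {𝒥 𝒥' : Set (Set X)}
    (h : LocallyFiniteClopen 𝒥) (h' : LocallyFiniteClopen 𝒥') :
    LocallyFiniteClopen (𝒥 ∪ 𝒥') where
  isClopen J hJ := hJ.elim (h.isClopen J) (h'.isClopen J)
  finite z := by
    obtain ⟨V, hV, hf⟩ := h.finite z
    obtain ⟨V', hV', hf'⟩ := h'.finite z
    refine ⟨V ∩ V', Filter.inter_mem hV hV', (hf.union hf').subset ?_⟩
    rintro J ⟨hJ | hJ, v, hv, w, hw, hvw⟩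
    · exact Or.inl ⟨hJ, v, hv.1, w, hw.1, hvw⟩
    · exact Or.inr ⟨hJ, v, hv.2, w, hw.2, hvw⟩

theorem LocallyFiniteClopen.isOpen_setOf_forall_mem_iff {X : Type*} [TopologicalSpace X]
    {𝒥 : Set (Set X)} (h𝒥 : LocallyFiniteClopen 𝒥) (x : X) :
    IsOpen {y | ∀ J ∈ 𝒥, x ∈ J ↔ y ∈ J} := by
  rw [isOpen_iff_mem_nhds]
  intro y hy
  obtain ⟨V, hV, hf⟩ := h𝒥.finite y
  have hopen : ⋂ J ∈ {J ∈ 𝒥 | ∃ v ∈ V, ∃ w ∈ V, v ∈ J ∧ w ∉ J}, {w | y ∈ J ↔ w ∈ J} ∈ 𝓝 y := by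
    rw [Filter.biInter_mem hf]
    intro J hJ
    by_cases hyJ : y ∈ J
    · filter_upwards [(h𝒥.isClopen J hJ.1).isOpen.mem_nhds hyJ] with w hw
      exact iff_of_true hyJ hw
    · filter_upwards [(h𝒥.isClopen J hJ.1).compl.isOpen.mem_nhds hyJ] with w hw
      exact iff_of_false hyJ hw
  filter_upwards [hV, hopen] with w hw hw' J hJ
  rw [hy J hJ]
  by_contra hne
  apply hne
  refine mem_iInter₂.1 hw' J ⟨hJ, ?_⟩
  have hyV := mem_of_mem_nhds hV
  by_cases hyJ : y ∈ J
  · exact ⟨y, hyV, w, hw, hyJ, fun h => hne (iff_of_true hyJ h)⟩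
  · exact ⟨w, hw, y, hyV, by_contra fun h => hne (iff_of_false hyJ h), hyJ⟩

section Separation

variable {X : Type*} [TopologicalSpace X] [LinearOrder X]

/-- Clopen initial segments ending at the right end of a maximal run of points of `A` not
interrupted by points of `B`. -/
def runCuts (A B : Set X) : Set (Set X) :=
  {J | IsClopen J ∧ IsLowerSet J ∧ (∃ a ∈ A, a ∈ J ∧ ∀ y ∈ B, y ∈ J → y < a) ∧
    ∀ x ∈ A, x ∉ J → ∃ y ∈ B, y ∉ J ∧ y < x}

theorem inter_eq_inter_of_mem_runCuts {A B V J₁ J₂ : Set X} (hV : V.OrdConnected)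
    (hAB : Disjoint V A ∨ Disjoint V B) (h₁ : J₁ ∈ runCuts A B) (h₂ : J₂ ∈ runCuts A B)
    (hs₁ : ∃ v ∈ V, ∃ w ∈ V, v ∈ J₁ ∧ w ∉ J₁) (hs₂ : ∃ v ∈ V, ∃ w ∈ V, v ∈ J₂ ∧ w ∉ J₂) :
    J₁ ∩ (A ∪ B) = J₂ ∩ (A ∪ B) := by
  wlog h : J₁ ⊆ J₂ generalizing J₁ J₂
  · exact (this h₂ h₁ hs₂ hs₁ ((h₁.2.1.total h₂.2.1).resolve_left h)).symm
  refine Subset.antisymm (inter_subset_inter_left _ h) ?_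
  obtain ⟨v, hv, -, -, hv₁, -⟩ := hs₁
  obtain ⟨-, -, w, hw, -, hw₂⟩ := hs₂
  have key : ∀ t, t ∈ J₂ → t ∉ J₁ → t ∈ V := fun t ht₂ ht₁ => hV.out hv hw
    ⟨le_of_not_ge fun h => ht₁ (h₁.2.1 h hv₁), le_of_not_ge fun h => hw₂ (h₂.2.1 h ht₂)⟩
  rintro t ⟨ht₂, htAB⟩
  refine ⟨by_contra fun ht₁ => ?_, htAB⟩
  rcases hAB with hd | hd
  · have htB := htAB.resolve_left fun htA => hd.le_bot ⟨key t ht₂ ht₁, htA⟩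
    obtain ⟨a, ha, haJ, haB⟩ := h₂.2.2.1
    exact hd.le_bot ⟨key a haJ fun ha₁ => ht₁ (h₁.2.1 (haB t htB ht₂).le ha₁), ha⟩
  · have htA := htAB.resolve_right fun htB => hd.le_bot ⟨key t ht₂ ht₁, htB⟩
    obtain ⟨y, hyB, hyJ, hyt⟩ := h₁.2.2.2 t htA ht₁
    exact hd.le_bot ⟨key y (h₂.2.1 hyt.le ht₂) hyJ, hyB⟩

variable [CompatibleOrder X] [TotallyDisconnectedSpace X]

theorem exists_mem_runCuts {A B : Set X} (hA : IsClosed A) (hB : IsClosed B)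
    (hd : Disjoint A B) {a b : X} (ha : a ∈ A) (hb : b ∈ B) (hab : a < b) :
    ∃ J ∈ runCuts A B, a ∈ J ∧ b ∉ J := by
  have hne : ∀ x ∈ A, ∀ y ∈ B, x ≠ y := fun x hx y hy h => hd.le_bot ⟨hx, h ▸ hy⟩
  by_cases hmin : ∃ m ∈ B, a ≤ m ∧ ∀ y ∈ B, a ≤ y → m ≤ y
  swap
  · push Not at hmin
    refine ⟨{z | ∀ y ∈ B, a ≤ y → z < y}, ⟨⟨?_, ?_⟩, ?_, ?_, ?_⟩, ?_, ?_⟩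
    · rw [← isOpen_compl_iff, isOpen_iff_forall_mem_open]
      intro z hz
      simp only [mem_compl_iff, mem_ofPred_eq, not_forall, not_lt] at hz
      obtain ⟨y, hy, hay, hyz⟩ := hz
      obtain ⟨y', hy', hay', hlt⟩ := hmin y hy hay
      exact ⟨Ioi y', fun w hw h => lt_asymm (h y' hy' hay') hw, isOpen_Ioi' y',
        lt_of_lt_of_le hlt hyz⟩
    · rw [isOpen_iff_forall_mem_open]
      intro z hz
      rcases lt_or_ge z a with hza | haz
      · exact ⟨Iio a, fun w hw y _ hay => lt_of_lt_of_le hw hay, isOpen_Iio' a, hza⟩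
      · obtain ⟨V, hV, hzV, hVB, hc⟩ := exists_ordConnected z Bᶜ hB.isOpen_compl
          (fun h => lt_irrefl z (hz z h haz))
        refine ⟨V, fun w hw y hy hay => not_le.1 fun hyw => ?_, hV, hzV⟩
        exact hVB (hc.out hzV hw ⟨(hz y hy hay).le, hyw⟩) hy
    · exact fun z w hwz hz y hy hay => lt_of_le_of_lt hwz (hz y hy hay)
    · exact ⟨a, ha, fun y hy hay => lt_of_le_of_ne hay (hne a ha y hy),
        fun y hy hyJ => not_le.1 fun hay => lt_irrefl y (hyJ y hy hay)⟩
    · intro x hx hxJ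
      simp only [mem_ofPred_eq, not_forall, not_lt] at hxJ
      obtain ⟨y, hy, hay, hyx⟩ := hxJ
      exact ⟨y, hy, fun h => lt_irrefl y (h y hy hay), lt_of_le_of_ne hyx (hne x hx y hy).symm⟩
    · exact fun y hy hay => lt_of_le_of_ne hay (hne a ha y hy)
    · exact fun h => lt_irrefl b (h b hb hab.le)
  obtain ⟨m, hm, ham, hmin⟩ := hmin
  have ham : a < m := lt_of_le_of_ne ham (hne a ha m hm)
  -- any clopen initial segment between the last point of `A` below `m` and `m` will do
  suffices ∃ J : Set X, IsClopen J ∧ IsLowerSet J ∧ a ∈ J ∧ m ∉ J ∧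
      ∀ x ∈ A, x ∉ J → m < x by
    obtain ⟨J, hJ, hJl, haJ, hmJ, hJA⟩ := this
    refine ⟨J, ⟨hJ, hJl, ⟨a, ha, haJ, fun y hy hyJ => not_le.1 fun hay => ?_⟩,
      fun x hx hxJ => ⟨m, hm, hmJ, hJA x hx hxJ⟩⟩, haJ, fun h => hmJ (hJl (hmin b hb hab.le) h)⟩
    exact hmJ (hJl (hmin y hy hay) hyJ)
  by_cases hmax : ∃ n ∈ A, n ≤ m ∧ ∀ x ∈ A, x ≤ m → x ≤ n
  · obtain ⟨n, hn, hnm, hmax⟩ := hmax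
    obtain ⟨J, hJ, hJl, hnJ, hmJ⟩ := exists_isClopen_isLowerSet
      (lt_of_le_of_ne hnm (hne n hn m hm)) (by
        rw [connectedComponent_eq_singleton]
        exact fun h => hne n hn m hm h.symm)
    exact ⟨J, hJ, hJl, hJl (hmax a ha ham.le) hnJ, hmJ,
      fun x hx hxJ => not_le.1 fun hxm => hxJ (hJl (hmax x hx hxm) hnJ)⟩
  · push Not at hmax
    refine ⟨{z | ∃ x ∈ A, x ≤ m ∧ z ≤ x}, ⟨?_, ?_⟩, ?_, ⟨a, ha, ham.le, le_rfl⟩, ?_, ?_⟩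
    · rw [← isOpen_compl_iff, isOpen_iff_forall_mem_open]
      intro z hz
      rcases lt_or_ge m z with hmz | hzm
      · refine ⟨Ioi m, ?_, isOpen_Ioi' m, hmz⟩
        rintro w hw ⟨x, -, hxm, hwx⟩
        exact not_lt.2 (hwx.trans hxm) hw
      · obtain ⟨V, hV, hzV, hVA, hc⟩ := exists_ordConnected z Aᶜ hA.isOpen_compl
          (fun h => hz ⟨z, h, hzm, le_rfl⟩)
        refine ⟨V, ?_, hV, hzV⟩
        rintro w hw ⟨x, hx, hxm, hwx⟩
        exact hVA (hc.out hw hzV ⟨hwx, le_of_not_ge fun h => hz ⟨x, hx, hxm, h⟩⟩) hx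
    · rw [isOpen_iff_forall_mem_open]
      rintro z ⟨x, hx, hxm, hzx⟩
      obtain ⟨x', hx', hxm', hlt⟩ := hmax x hx hxm
      exact ⟨Iio x', fun w hw => ⟨x', hx', hxm', le_of_lt hw⟩, isOpen_Iio' x',
        lt_of_le_of_lt hzx hlt⟩
    · rintro z w hwz ⟨x, hx, hxm, hzx⟩
      exact ⟨x, hx, hxm, hwz.trans hzx⟩
    · rintro ⟨x, hx, hxm, hmx⟩
      exact hne x hx m hm (le_antisymm hxm hmx)
    · exact fun x hx hxJ => not_le.1 fun hxm => hxJ ⟨x, hx, hxm, le_rfl⟩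

theorem exists_locallyFinite_cuts {A B : Set X} (hA : IsClosed A) (hB : IsClosed B)
    (hd : Disjoint A B) :
    ∃ 𝒥 : Set (Set X), LocallyFiniteClopen 𝒥 ∧
      ∀ a ∈ A, ∀ b ∈ B, a < b → ∃ J ∈ 𝒥, a ∈ J ∧ b ∉ J := by
  obtain ⟨𝒥, hsub, hbij⟩ := exists_subset_bijOn (runCuts A B) (· ∩ (A ∪ B))
  refine ⟨𝒥, ⟨fun J hJ => (hsub hJ).1, fun z => ?_⟩, fun a ha b hb hab => ?_⟩
  · obtain ⟨V, hV, hzV, hc, hVAB⟩ : ∃ V : Set X, IsOpen V ∧ z ∈ V ∧ V.OrdConnected ∧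
        (Disjoint V A ∨ Disjoint V B) := by
      by_cases hzA : z ∈ A
      · obtain ⟨V, hV, hzV, hVB, hc⟩ := exists_ordConnected z Bᶜ hB.isOpen_compl
          (fun h => hd.le_bot ⟨hzA, h⟩)
        exact ⟨V, hV, hzV, hc, Or.inr (disjoint_left.2 hVB)⟩
      · obtain ⟨V, hV, hzV, hVA, hc⟩ := exists_ordConnected z Aᶜ hA.isOpen_compl hzA
        exact ⟨V, hV, hzV, hc, Or.inl (disjoint_left.2 hVA)⟩
    refine ⟨V, hV.mem_nhds hzV,
      Set.Subsingleton.finite fun J₁ h₁ J₂ h₂ => hbij.injOn h₁.1 h₂.1 ?_⟩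
    exact inter_eq_inter_of_mem_runCuts hc hVAB (hsub h₁.1) (hsub h₂.1) h₁.2 h₂.2
  · obtain ⟨J, hJ, haJ, hbJ⟩ := exists_mem_runCuts hA hB hd ha hb hab
    obtain ⟨J', hJ', heq⟩ := hbij.surjOn (mem_image_of_mem _ hJ)
    simp only [Set.ext_iff] at heq
    refine ⟨J', hJ', ((heq a).2 ⟨haJ, Or.inl ha⟩).1, fun h => hbJ ?_⟩
    exact ((heq b).1 ⟨h, Or.inr hb⟩).1

theorem exists_isClopen_of_disjoint {A B : Set X} (hA : IsClosed A) (hB : IsClosed B)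
    (hd : Disjoint A B) : ∃ H : Set X, IsClopen H ∧ A ⊆ H ∧ Disjoint H B := by
  obtain ⟨𝒥, h𝒥, hsep⟩ := exists_locallyFinite_cuts hA hB hd
  obtain ⟨𝒥', h𝒥', hsep'⟩ := exists_locallyFinite_cuts hB hA hd.symm
  have hopen := (h𝒥.union h𝒥').isOpen_setOf_forall_mem_iff
  refine ⟨{y | ∃ a ∈ A, ∀ J ∈ 𝒥 ∪ 𝒥', a ∈ J ↔ y ∈ J}, ⟨?_, ?_⟩,
    fun a ha => ⟨a, ha, fun _ _ => Iff.rfl⟩, disjoint_left.2 ?_⟩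
  · rw [← isOpen_compl_iff, isOpen_iff_forall_mem_open]
    refine fun y hy => ⟨_, ?_, hopen y, fun _ _ => Iff.rfl⟩
    rintro z hz ⟨a, ha, haz⟩
    exact hy ⟨a, ha, fun J hJ => (haz J hJ).trans (hz J hJ).symm⟩
  · rw [isOpen_iff_forall_mem_open]
    rintro y ⟨a, ha, hay⟩
    exact ⟨_, fun z hz => ⟨a, ha, hz⟩, hopen a, hay⟩
  · rintro b ⟨a, ha, hab⟩ hb
    rcases lt_trichotomy a b with h | rfl | h
    · obtain ⟨J, hJ, haJ, hbJ⟩ := hsep a ha b hb h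
      exact hbJ ((hab J (Or.inl hJ)).1 haJ)
    · exact hd.le_bot ⟨ha, hb⟩
    · obtain ⟨J, hJ, hbJ, haJ⟩ := hsep' b hb a ha h
      exact haJ ((hab J (Or.inr hJ)).2 hbJ)

theorem exists_disjoint_refinement {𝒰 : Set (Set X)} (hfin : 𝒰.Finite)
    (hopen : ∀ U ∈ 𝒰, IsOpen U) {C : Set X} (hC : IsClopen C) (hCU : C ⊆ ⋃₀ 𝒰) :
    ∃ 𝒱 : Set (Set X), 𝒱.Finite ∧ (∀ V ∈ 𝒱, IsOpen V) ∧ ⋃₀ 𝒱 = C ∧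
      (∀ V ∈ 𝒱, ∃ U ∈ 𝒰, V ⊆ U) ∧ ∀ V ∈ 𝒱, ∀ W ∈ 𝒱, V ≠ W → V ∩ W = ∅ := by
  induction 𝒰, hfin using Set.Finite.induction_on generalizing C with
  | empty => exact ⟨∅, finite_empty, by simp, by simpa [eq_comm] using hCU, by simp, by simp⟩
  | @insert U 𝒰 _ _ ih =>
    have hopen' : ∀ W ∈ 𝒰, IsOpen W := fun W hW => hopen W (mem_insert_of_mem _ hW)
    have hU : IsOpen U := hopen U (mem_insert _ _)
    obtain ⟨H, hH, hsub, hHU⟩ := exists_isClopen_of_disjoint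
      (A := C \ ⋃₀ 𝒰) (B := Uᶜ) (hC.isClosed.sdiff (isOpen_sUnion hopen')) hU.isClosed_compl (by
        rw [disjoint_left]
        rintro x ⟨hx, hx𝒰⟩ hxU
        rcases hCU hx with ⟨W, rfl | hW, hxW⟩
        · exact hxU hxW
        · exact hx𝒰 ⟨W, hW, hxW⟩)
    obtain ⟨𝒱, h𝒱, ho, hun, href, hdis⟩ := ih hopen' (hC.diff hH)
      (fun x hx => by_contra fun h => hx.2 (hsub ⟨hx.1, h⟩))
    have hdis' : ∀ V ∈ 𝒱, C ∩ H ∩ V = ∅ := by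
      intro V hV
      refine eq_empty_of_forall_notMem fun x hx => ?_
      have : x ∈ C \ H := hun ▸ ⟨V, hV, hx.2⟩
      exact this.2 hx.1.2
    refine ⟨insert (C ∩ H) 𝒱, h𝒱.insert _, ?_, ?_, ?_, ?_⟩
    · rintro V (rfl | hV)
      · exact hC.isOpen.inter hH.isOpen
      · exact ho V hV
    · rw [sUnion_insert, hun, inter_union_sdiff]
    · rintro V (rfl | hV)
      · exact ⟨U, mem_insert _ _, fun x hx => by_contra fun h => hHU.le_bot ⟨hx.2, h⟩⟩
      · obtain ⟨W, hW, hVW⟩ := href V hV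
        exact ⟨W, mem_insert_of_mem _ hW, hVW⟩
    · rintro V (rfl | hV) W (rfl | hW) hne
      · exact absurd rfl hne
      · exact hdis' W hW
      · rw [inter_comm]
        exact hdis' V hV
      · exact hdis V hV W hW hne

theorem stronglyZeroDimensional : StronglyZeroDimensional X := fun _ hfin hopen hcov =>
  exists_disjoint_refinement hfin hopen isClopen_univ hcov.ge

end Separation

section Metrizable

/-- A distance function inducing the topology and monotone with respect to inclusion of order
intervals. -/
structure ConvexDist {X : Type*} [TopologicalSpace X] [LinearOrder X] (ρ : X → X → ℝ) :
    Prop where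
  self : ∀ x, ρ x x = 0
  symm : ∀ x y, ρ x y = ρ y x
  triangle : ∀ x y z, ρ x z ≤ ρ x y + ρ y z
  mono_left : ∀ {a b c}, a ≤ b → b ≤ c → ρ a b ≤ ρ a c
  mono_right : ∀ {a b c}, a ≤ b → b ≤ c → ρ b c ≤ ρ a c
  ball_mem : ∀ x ε, 0 < ε → {y | ρ x y < ε} ∈ 𝓝 x
  exists_ball : ∀ x, ∀ U ∈ 𝓝 x, ∃ ε, 0 < ε ∧ ∀ y, ρ x y < ε → y ∈ U

variable {X : Type*} [TopologicalSpace X] [LinearOrder X]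

theorem exists_convexDist [CompatibleOrder X] [TopologicalSpace.MetrizableSpace X] :
    ∃ ρ : X → X → ℝ, ConvexDist ρ := by
  let := TopologicalSpace.metrizableSpaceMetric X
  have hfin : ∀ s : Set X, min 1 (Metric.ediam s) ≠ ⊤ := fun s =>
    ((min_le_left _ _).trans_lt ENNReal.one_lt_top).ne
  have hmono : ∀ s t : Set X, s ⊆ t →
      (min 1 (Metric.ediam s)).toReal ≤ (min 1 (Metric.ediam t)).toReal := fun s t h =>
    ENNReal.toReal_mono (hfin t) (min_le_min_left 1 (Metric.ediam_mono h))
  refine ⟨fun x y => (min 1 (Metric.ediam (uIcc x y))).toReal, ?_, ?_, ?_, ?_, ?_, ?_, ?_⟩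
  · intro x
    simp
  · intro x y
    rw [uIcc_comm]
  · intro x y z
    rw [← ENNReal.toReal_add (hfin _) (hfin _)]
    refine ENNReal.toReal_mono (ENNReal.add_ne_top.2 ⟨hfin _, hfin _⟩) ?_
    have h : Metric.ediam (uIcc x z) ≤ Metric.ediam (uIcc x y) + Metric.ediam (uIcc y z) :=
      (Metric.ediam_mono uIcc_subset_uIcc_union_uIcc).trans
        (Metric.ediam_union_le ⟨y, right_mem_uIcc, left_mem_uIcc⟩)
    rcases le_total 1 (Metric.ediam (uIcc x y)) with h1 | h1
    · rw [min_eq_left h1]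
      exact (min_le_left _ _).trans le_self_add
    rcases le_total 1 (Metric.ediam (uIcc y z)) with h2 | h2
    · rw [min_eq_left h2]
      exact (min_le_left _ _).trans le_add_self
    rw [min_eq_right h1, min_eq_right h2]
    exact (min_le_right _ _).trans h
  · intro a b c hab hbc
    refine hmono _ _ ?_
    rw [uIcc_of_le hab, uIcc_of_le (hab.trans hbc)]
    exact Icc_subset_Icc_right hbc
  · intro a b c hab hbc
    refine hmono _ _ ?_
    rw [uIcc_of_le hbc, uIcc_of_le (hab.trans hbc)]
    exact Icc_subset_Icc_left hab
  · intro x ε hε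
    obtain ⟨V, hV, hxV, hVU, hc⟩ := exists_ordConnected x (Metric.ball x (ε / 4))
      Metric.isOpen_ball (Metric.mem_ball_self (by positivity))
    filter_upwards [hV.mem_nhds hxV] with y hy
    have h : Metric.ediam (uIcc x y) ≤ ENNReal.ofReal (ε / 2) := by
      refine Metric.ediam_le fun a ha b hb => ?_
      rw [edist_dist]
      refine ENNReal.ofReal_le_ofReal ?_
      have ha' : dist a x < ε / 4 := hVU (hc.uIcc_subset hxV hy ha)
      have hb' : dist b x < ε / 4 := hVU (hc.uIcc_subset hxV hy hb)
      linarith [dist_triangle_right a b x]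
    have h' := ENNReal.toReal_mono ENNReal.ofReal_ne_top ((min_le_right 1 _).trans h)
    rw [ENNReal.toReal_ofReal (by positivity)] at h'
    exact lt_of_le_of_lt h' (by linarith)
  · intro x U hU
    obtain ⟨ε, hε, hεU⟩ := Metric.mem_nhds_iff.1 hU
    refine ⟨min 1 ε, by positivity, fun y hy => hεU ?_⟩
    rw [Metric.mem_ball, dist_comm, dist_edist]
    have h1 : (min 1 (Metric.ediam (uIcc x y))).toReal < 1 := lt_of_lt_of_le hy (min_le_left _ _)
    have h2 : Metric.ediam (uIcc x y) ≤ 1 := by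
      by_contra h
      rw [min_eq_left (le_of_not_ge h)] at h1
      simp at h1
    have h3 : (Metric.ediam (uIcc x y)).toReal < ε := by
      rw [min_eq_right h2] at hy
      exact lt_of_lt_of_le hy (min_le_right _ _)
    exact lt_of_le_of_lt (ENNReal.toReal_mono (h2.trans_lt ENNReal.one_lt_top).ne
      (Metric.edist_le_ediam_of_mem left_mem_uIcc right_mem_uIcc)) h3

namespace ConvexDist

variable {ρ : X → X → ℝ}

theorem ordConnected_ball (hρ : ConvexDist ρ) (z : X) (r : ℝ) : OrdConnected {y | ρ z y < r} := by
  refine ⟨fun a ha b hb c hc => ?_⟩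
  rcases le_total c z with h | h
  · have ha : ρ z a < r := ha
    rw [hρ.symm] at ha
    rw [mem_ofPred_eq, hρ.symm]
    exact lt_of_le_of_lt (hρ.mono_right hc.1 h) ha
  · exact lt_of_le_of_lt (hρ.mono_left h hc.2) hb

theorem lt_of_mem_ball (hρ : ConvexDist ρ) {z v w : X} {ε : ℝ} (hv : ρ z v < ε / 2)
    (hw : ρ z w < ε / 2) :
    ρ v w < ε := by
  have := hρ.triangle v z w
  rw [hρ.symm v z] at this
  linarith

theorem exists_maximal_separated (hρ : ConvexDist ρ) (ε : ℝ) :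
    ∃ D : Set X, D.Pairwise (fun x y => ε ≤ ρ x y) ∧ (0 < ε → ∀ x, ∃ d ∈ D, ρ x d < ε) := by
  obtain ⟨D, hD⟩ := zorn_subset {S : Set X | S.Pairwise fun x y => ε ≤ ρ x y} (by
    intro c hc hchain
    exact ⟨⋃₀ c, (pairwise_sUnion hchain.directedOn).2 fun s hs => hc hs,
      fun s hs => subset_sUnion_of_mem hs⟩)
  refine ⟨D, hD.prop, fun hε x => ?_⟩
  by_contra! h
  have hins : (insert x D).Pairwise fun x y => ε ≤ ρ x y := by
    refine hD.prop.insert fun y hy _ => ⟨h y hy, ?_⟩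
    rw [hρ.symm]
    exact h y hy
  have := h x (hD.le_of_ge hins (subset_insert x D) (mem_insert x D))
  rw [hρ.self] at this
  exact not_lt.2 this hε

/-- The classes of points linked by chains of steps shorter than `ε`. -/
theorem locallyFiniteClopen_chains (hρ : ConvexDist ρ) {ε : ℝ} (hε : 0 < ε) :
    LocallyFiniteClopen
      (range fun x => {y | Relation.ReflTransGen (fun a b => ρ a b < ε) x y}) where
  isClopen := by
    rintro _ ⟨x, rfl⟩
    constructor
    · rw [← isOpen_compl_iff, isOpen_iff_mem_nhds]
      intro y hy
      filter_upwards [hρ.ball_mem y ε hε] with z hz h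
      refine hy (Relation.ReflTransGen.tail h ?_)
      rw [hρ.symm]
      exact hz
    · rw [isOpen_iff_mem_nhds]
      intro y hy
      filter_upwards [hρ.ball_mem y ε hε] with z hz
      exact Relation.ReflTransGen.tail hy hz
  finite z := by
    refine ⟨_, hρ.ball_mem z (ε / 2) (by positivity), ?_⟩
    convert finite_empty
    refine eq_empty_of_forall_notMem ?_
    rintro _ ⟨⟨x, rfl⟩, v, hv, w, hw, hvJ, hwJ⟩
    exact hwJ (Relation.ReflTransGen.tail hvJ (hρ.lt_of_mem_ball hv hw))

theorem finite_inter_uIcc (hρ : ConvexDist ρ) {D : Set X} {ε : ℝ}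
    (hD : D.Pairwise fun x y => ε ≤ ρ x y) {x y : X}
    (h : Relation.ReflTransGen (fun a b => ρ a b < ε) x y) : (D ∩ uIcc x y).Finite := by
  induction h with
  | refl => exact (finite_singleton x).subset fun z hz => by simpa using hz.2
  | @tail z w _ hzw ih =>
    have hsub : (D ∩ uIcc z w).Subsingleton := by
      have aux : ∀ a ∈ D ∩ uIcc z w, ∀ b ∈ D ∩ uIcc z w, a ≤ b → a = b := by
        rintro a ⟨ha, ha'⟩ b ⟨hb, hb'⟩ hab
        by_contra hne
        refine not_lt.2 (hD ha hb hne) (lt_of_le_of_lt ?_ hzw)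
        rw [mem_uIcc] at ha' hb'
        rcases le_total z w with h | h
        · rw [← mem_uIcc, uIcc_of_le h] at ha' hb'
          exact (hρ.mono_left hab hb'.2).trans (hρ.mono_right ha'.1 (hab.trans hb'.2))
        · rw [← mem_uIcc, uIcc_of_ge h] at ha' hb'
          rw [hρ.symm z w]
          exact (hρ.mono_left hab hb'.2).trans (hρ.mono_right ha'.1 (hab.trans hb'.2))
      intro a ha b hb
      rcases le_total a b with h | h
      · exact aux a ha b hb h
      · exact (aux b hb a ha h).symm
    refine (ih.union hsub.finite).subset ?_
    rw [← inter_union_distrib_left]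
    exact inter_subset_inter_right _ uIcc_subset_uIcc_union_uIcc

theorem le_of_forall_notMem (hρ : ConvexDist ρ) {D : Set X} {ε : ℝ} (hε : 0 < ε)
    (hD : ∀ x, ∃ d ∈ D, ρ x d < ε)
    {x y : X} (hxy : x ≤ y) (h : Relation.ReflTransGen (fun a b => ρ a b < ε) x y)
    (hno : ∀ d ∈ D, x < d → y ≤ d) : ρ x y ≤ 3 * ε := by
  by_contra! hlt
  suffices ∀ z, Relation.ReflTransGen (fun a b => ρ a b < ε) x z → x ≤ z → ρ x z < ε by
    linarith [this y h hxy]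
  intro z hz
  induction hz with
  | refl => intro _; rwa [hρ.self]
  | @tail z w _ hzw ih =>
    intro hxw
    rcases le_total x z with hxz | hzx
    · have hxw' : ρ x w < 2 * ε := by linarith [hρ.triangle x z w, ih hxz]
      have hwy : w < y := not_le.1 fun h => by linarith [hρ.mono_left hxy h]
      obtain ⟨d, hd, hwd⟩ := hD w
      rcases le_or_gt d x with hdx | hxd
      · rw [hρ.symm] at hwd
        exact lt_of_le_of_lt (hρ.mono_right hdx hxw) hwd
      · linarith [hρ.triangle x w y, hρ.mono_left hwy.le (hno d hd hxd)]
    · exact lt_of_le_of_lt (hρ.mono_right hzx hxw) hzw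

/-- Clopen initial segments separating consecutive points of a separated set form a locally finite
family. -/
theorem locallyFiniteClopen_consecutive (hρ : ConvexDist ρ) {D : Set X} {ε : ℝ} (hε : 0 < ε)
    (hD : D.Pairwise fun x y => ε ≤ ρ x y) (cut : X → X → Set X)
    (hcut : ∀ d d', d < d' → d' ∉ connectedComponent d →
      IsClopen (cut d d') ∧ IsLowerSet (cut d d') ∧ d ∈ cut d d' ∧ d' ∉ cut d d') :
    LocallyFiniteClopen {J : Set X | ∃ d ∈ D, ∃ d' ∈ D, d < d' ∧ (∀ e ∈ D, e ≤ d ∨ d' ≤ e) ∧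
      d' ∉ connectedComponent d ∧ J = cut d d'} where
  isClopen := by
    rintro _ ⟨d, -, d', -, hlt, -, hcomp, rfl⟩
    exact (hcut d d' hlt hcomp).1
  finite z := by
    refine ⟨_, hρ.ball_mem z (ε / 2) (by positivity), ?_⟩
    set V := {y | ρ z y < ε / 2}
    have hc : V.OrdConnected := hρ.ordConnected_ball z (ε / 2)
    have hDV : ∀ d ∈ D, ∀ e ∈ D, d ∈ V → e ∈ V → d = e := fun d hd e he hdV heV =>
      by_contra fun hne => not_lt.2 (hD hd he hne) (hρ.lt_of_mem_ball hdV heV)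
    have hnext : ∀ d d₁ d₂, d₁ ∈ D → d₂ ∈ D → d < d₁ → d < d₂ → (∀ e ∈ D, e ≤ d ∨ d₁ ≤ e) →
        (∀ e ∈ D, e ≤ d ∨ d₂ ≤ e) → d₁ = d₂ := fun d d₁ d₂ h₁ h₂ hl₁ hl₂ hc₁ hc₂ =>
      le_antisymm ((hc₁ d₂ h₂).resolve_left (not_le.2 hl₂))
        ((hc₂ d₁ h₁).resolve_left (not_le.2 hl₁))
    let good : X → X → Prop := fun d d' => d ∈ D ∧ d' ∈ D ∧ d < d' ∧ (∀ e ∈ D, e ≤ d ∨ d' ≤ e) ∧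
      d' ∉ connectedComponent d ∧ ∃ v ∈ V, ∃ w ∈ V, v ∈ cut d d' ∧ w ∉ cut d d'
    have hbelow : ∀ d d', good d d' → d ∉ V → ∀ v ∈ V, d < v := by
      rintro d d' ⟨-, -, hlt, -, hcomp, -, -, w, hw, -, hwJ⟩ hdV v hv
      obtain ⟨-, hJl, hdJ, -⟩ := hcut d d' hlt hcomp
      exact not_le.1 fun h => hdV (hc.out hv hw ⟨h, le_of_not_ge fun h' => hwJ (hJl h' hdJ)⟩)
    have hle : ∀ d₁ d₁' d₂ d₂', good d₁ d₁' → good d₂ d₂' → d₂ ∉ V → d₂ ≤ d₁ := by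
      intro d₁ d₁' d₂ d₂' h₁ h₂ hdV
      obtain ⟨-, -, hlt, hcons, hcomp, v, hv, -, -, hvJ, -⟩ := h₁
      obtain ⟨-, hJl, -, hdJ⟩ := hcut d₁ d₁' hlt hcomp
      refine (hcons d₂ h₂.1).resolve_right fun h => ?_
      exact hdJ (hJl (h.trans (hbelow d₂ d₂' h₂ hdV v hv).le) hvJ)
    have h₁ : {J | ∃ d d', good d d' ∧ d ∈ V ∧ J = cut d d'}.Subsingleton := by
      rintro _ ⟨d₁, d₁', g₁, hV₁, rfl⟩ _ ⟨d₂, d₂', g₂, hV₂, rfl⟩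
      obtain rfl := hDV d₁ g₁.1 d₂ g₂.1 hV₁ hV₂
      rw [hnext d₁ d₁' d₂' g₁.2.1 g₂.2.1 g₁.2.2.1 g₂.2.2.1 g₁.2.2.2.1 g₂.2.2.2.1]
    have h₂ : {J | ∃ d d', good d d' ∧ d ∉ V ∧ J = cut d d'}.Subsingleton := by
      rintro _ ⟨d₁, d₁', g₁, hV₁, rfl⟩ _ ⟨d₂, d₂', g₂, hV₂, rfl⟩
      obtain rfl := le_antisymm (hle d₂ d₂' d₁ d₁' g₂ g₁ hV₁) (hle d₁ d₁' d₂ d₂' g₁ g₂ hV₂)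
      rw [hnext d₁ d₁' d₂' g₁.2.1 g₂.2.1 g₁.2.2.1 g₂.2.2.1 g₁.2.2.2.1 g₂.2.2.2.1]
    refine (h₁.finite.union h₂.finite).subset ?_
    rintro _ ⟨⟨d, hd, d', hd', hlt, hcons, hcomp, rfl⟩, hsplit⟩
    by_cases hdV : d ∈ V
    · exact Or.inl ⟨d, d', ⟨hd, hd', hlt, hcons, hcomp, hsplit⟩, hdV, rfl⟩
    · exact Or.inr ⟨d, d', ⟨hd, hd', hlt, hcons, hcomp, hsplit⟩, hdV, rfl⟩

theorem le_of_mem_uIcc (hρ : ConvexDist ρ) {x y p : X} (hp : p ∈ uIcc x y) : ρ x p ≤ ρ x y := by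
  rcases le_total x y with h | h
  · rw [uIcc_of_le h] at hp
    exact hρ.mono_left hp.1 hp.2
  · rw [uIcc_of_ge h] at hp
    rw [hρ.symm x p, hρ.symm x y]
    exact hρ.mono_right hp.1 hp.2

theorem chain_of_mem_uIcc (hρ : ConvexDist ρ) {ε : ℝ} {x y p : X}
    (h : Relation.ReflTransGen (fun a b => ρ a b < ε) x y) (hp : p ∈ uIcc x y) :
    Relation.ReflTransGen (fun a b => ρ a b < ε) x p := by
  induction h with
  | refl =>
    obtain rfl : p = x := by simpa using hp
    exact Relation.ReflTransGen.refl
  | @tail z w hz hzw ih =>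
    rcases uIcc_subset_uIcc_union_uIcc (b := z) hp with h | h
    · exact ih h
    · exact hz.tail (lt_of_le_of_lt (hρ.le_of_mem_uIcc h) hzw)

theorem chain_symm (hρ : ConvexDist ρ) {ε : ℝ} {x y : X}
    (h : Relation.ReflTransGen (fun a b => ρ a b < ε) x y) :
    Relation.ReflTransGen (fun a b => ρ a b < ε) y x :=
  (@Relation.ReflTransGen.stdSymm _ _ ⟨fun a b hab => by rwa [hρ.symm]⟩).symm _ _ h

variable [CompatibleOrder X]

/-- Initial segments cut off by components without a last point, of size at least `ε`. -/
theorem locallyFiniteClopen_ends (hρ : ConvexDist ρ) {ε : ℝ} (hε : 0 < ε) :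
    LocallyFiniteClopen {J : Set X | ∃ x, (∀ k ∈ connectedComponent x,
      ∃ k' ∈ connectedComponent x, k < k') ∧ (∃ z ∈ connectedComponent x, ε ≤ ρ x z) ∧
      J = {y | ∃ k ∈ connectedComponent x, y ≤ k}} where
  isClopen := by
    rintro _ ⟨x, hmax, -, rfl⟩
    constructor
    · rw [← isOpen_compl_iff, isOpen_iff_forall_mem_open]
      intro y hy
      obtain ⟨V, hV, hyV, hVK, hc⟩ := exists_ordConnected y (connectedComponent x)ᶜ
        isClosed_connectedComponent.isOpen_compl fun h => hy ⟨y, h, le_rfl⟩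
      refine ⟨V, ?_, hV, hyV⟩
      rintro v hv ⟨k, hk, hvk⟩
      exact hVK (hc.out hv hyV ⟨hvk, le_of_not_ge fun h => hy ⟨k, hk, h⟩⟩) hk
    · rw [isOpen_iff_forall_mem_open]
      rintro y ⟨k, hk, hyk⟩
      obtain ⟨k', hk', hlt⟩ := hmax k hk
      exact ⟨Iio k', fun z hz => ⟨k', hk', le_of_lt hz⟩, isOpen_Iio' k',
        lt_of_le_of_lt hyk hlt⟩
  finite z := by
    refine ⟨_, hρ.ball_mem z (ε / 2) (by positivity), Set.Subsingleton.finite ?_⟩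
    have hc := hρ.ordConnected_ball z (ε / 2)
    have key : ∀ x v w : X, ρ z v < ε / 2 → ρ z w < ε / 2 →
        (∃ y ∈ connectedComponent x, ε ≤ ρ x y) → (∃ k ∈ connectedComponent x, v ≤ k) →
        (¬ ∃ k ∈ connectedComponent x, w ≤ k) →
        ∃ k, connectedComponent k = connectedComponent x ∧ ρ z k < ε / 2 ∧
          ∃ l ∈ connectedComponent k, ¬ ρ z l < ε / 2 ∧ l < w := by
      rintro x v w hv hw ⟨y, hy, hxy⟩ ⟨k, hk, hvk⟩ hno
      have hlt : ∀ k ∈ connectedComponent x, k < w := fun k hk =>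
        not_le.1 fun h => hno ⟨k, hk, h⟩
      refine ⟨k, (connectedComponent_eq hk).symm, hc.out hv hw ⟨hvk, (hlt k hk).le⟩, ?_⟩
      rw [← connectedComponent_eq hk]
      by_cases hx : ρ z x < ε / 2
      · exact ⟨y, hy, fun h => not_lt.2 hxy (hρ.lt_of_mem_ball hx h), hlt y hy⟩
      · exact ⟨x, mem_connectedComponent, hx, hlt x mem_connectedComponent⟩
    rintro _ ⟨⟨x₁, -, hx₁, rfl⟩, v₁, hv₁, w₁, hw₁, hvJ₁, hwJ₁⟩
      _ ⟨⟨x₂, -, hx₂, rfl⟩, v₂, hv₂, w₂, hw₂, hvJ₂, hwJ₂⟩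
    obtain ⟨k₁, he₁, hk₁, l₁, hl₁, hn₁, hlt₁⟩ := key x₁ v₁ w₁ hv₁ hw₁ hx₁ hvJ₁ hwJ₁
    obtain ⟨k₂, he₂, hk₂, l₂, hl₂, hn₂, hlt₂⟩ := key x₂ v₂ w₂ hv₂ hw₂ hx₂ hvJ₂ hwJ₂
    have hlt₁' : l₁ < w₂ := not_le.1 fun h => hn₁ (hc.out hw₂ hw₁ ⟨h, hlt₁.le⟩)
    have heq : connectedComponent k₁ = connectedComponent k₂ :=
      connectedComponent_eq_of_not_mem (X := Xᵒᵈ) hc.dual hw₂ hk₁ hk₂ hn₁ hn₂ hlt₁' hlt₂ hl₁ hl₂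
    rw [← he₁, ← he₂, heq]

/-- At scale `ε`, a locally finite clopen family such that unseparated points are joined, up to
steps of length `3 * ε`, by a single component. -/
theorem exists_cuts_scale (hρ : ConvexDist ρ) {ε : ℝ} (hε : 0 < ε) :
    ∃ 𝒥 : Set (Set X), LocallyFiniteClopen 𝒥 ∧
      ∀ x y, x ≤ y → (∀ J ∈ 𝒥, x ∈ J ↔ y ∈ J) → ∃ p q, x ≤ p ∧ p ≤ q ∧ q ≤ y ∧
        q ∈ connectedComponent p ∧ ρ x p ≤ 3 * ε ∧ ρ q y ≤ 3 * ε := by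
  obtain ⟨D, hDsep, hDmax⟩ := hρ.exists_maximal_separated ε
  have hDmax := hDmax hε
  have hcut : ∀ d d' : X, d < d' → d' ∉ connectedComponent d →
      ∃ J : Set X, IsClopen J ∧ IsLowerSet J ∧ d ∈ J ∧ d' ∉ J := fun d d' h h' =>
    exists_isClopen_isLowerSet h h'
  choose! cut hcut using hcut
  refine ⟨_, (hρ.locallyFiniteClopen_chains hε).union
    (hρ.locallyFiniteClopen_consecutive hε hDsep cut hcut), fun x y hxy h => ?_⟩
  have chain : Relation.ReflTransGen (fun a b => ρ a b < ε) x y :=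
    (h _ (Or.inl ⟨x, rfl⟩)).1 Relation.ReflTransGen.refl
  have hfin : (D ∩ Icc x y).Finite := uIcc_of_le hxy ▸ hρ.finite_inter_uIcc hDsep chain
  rcases (D ∩ Icc x y).eq_empty_or_nonempty with hemp | hne
  · refine ⟨x, x, le_rfl, le_rfl, hxy, mem_connectedComponent, ?_, ?_⟩
    · rw [hρ.self]
      positivity
    · refine hρ.le_of_forall_notMem hε hDmax hxy chain fun d hd hxd => le_of_not_ge fun hdy => ?_
      exact hemp.subset ⟨hd, hxd.le, hdy⟩
  obtain ⟨p, ⟨hpD, hxp, hpy⟩, hpmin⟩ := hfin.exists_minimal hne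
  have hpmin : ∀ d ∈ D, x ≤ d → d ≤ y → p ≤ d := fun d hd hxd hdy =>
    (le_total p d).elim id fun h => hpmin ⟨hd, hxd, hdy⟩ h
  -- the last point of `D` in `[x, y]` lying in the component of `p`
  obtain ⟨q, ⟨⟨hqD, hxq, hqy⟩, hqp⟩, hqmax⟩ :=
    (hfin.subset (inter_subset_left (t := connectedComponent p))).exists_maximal
      ⟨p, ⟨hpD, hxp, hpy⟩, mem_connectedComponent⟩
  have hqlast : ∀ d ∈ D, q < d → y < d := by
    by_contra! hex
    obtain ⟨e₀, he₀, hqe₀, he₀y⟩ := hex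
    obtain ⟨e, ⟨⟨heD, hxe, hey⟩, hqe⟩, hemin⟩ :=
      (hfin.subset (inter_subset_left (t := Ioi q))).exists_minimal
        ⟨e₀, ⟨he₀, hxq.trans hqe₀.le, he₀y⟩, hqe₀⟩
    have hep : e ∉ connectedComponent p := fun h =>
      not_le.2 hqe (hqmax ⟨⟨heD, hxe, hey⟩, h⟩ (le_of_lt hqe))
    have heq : e ∉ connectedComponent q := connectedComponent_eq hqp ▸ hep
    obtain ⟨-, hJl, hqJ, heJ⟩ := hcut q e hqe heq
    have hsep := h (cut q e) (Or.inr ⟨q, hqD, e, heD, hqe, fun d hd => ?_, heq, rfl⟩)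
    · exact heJ (hJl hey (hsep.1 (hJl hxq hqJ)))
    · rcases le_or_gt d q with hdq | hqd
      · exact Or.inl hdq
      · rcases le_total e d with hed | hde
        · exact Or.inr hed
        · exact Or.inr (hemin ⟨⟨hd, hxq.trans hqd.le, hde.trans hey⟩, hqd⟩ hde)
  refine ⟨p, q, hxp, hpmin q hqD hxq hqy, hqy, hqp, ?_, ?_⟩
  · refine hρ.le_of_forall_notMem hε hDmax hxp
      (hρ.chain_of_mem_uIcc chain (Icc_subset_uIcc ⟨hxp, hpy⟩)) fun d hd hxd => ?_
    rcases le_total d y with h | h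
    · exact hpmin d hd hxd.le h
    · exact hpy.trans h
  · exact hρ.le_of_forall_notMem hε hDmax hqy (hρ.chain_symm (hρ.chain_of_mem_uIcc
      (hρ.chain_symm chain) (Icc_subset_uIcc' ⟨hxq, hqy⟩))) fun d hd hqd => (hqlast d hd hqd).le

theorem exists_cuts_seq (hρ : ConvexDist ρ) :
    ∃ 𝒥 : ℕ → Set (Set X), (∀ n, LocallyFiniteClopen (𝒥 n)) ∧
      ∀ x U, IsOpen U → (∀ u ∈ U, connectedComponent u ⊆ U) → x ∈ U →
        ∃ n, ∀ y, x ≤ y → (∀ J ∈ 𝒥 n, x ∈ J ↔ y ∈ J) → y ∈ U := by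
  choose cuts hcuts hsep using fun n : ℕ =>
    hρ.exists_cuts_scale (ε := 1 / ((n : ℝ) + 1)) Nat.one_div_pos_of_nat
  refine ⟨fun n => cuts n ∪ _, fun n => (hcuts n).union (hρ.locallyFiniteClopen_ends
    (ε := 1 / ((n : ℝ) + 1)) Nat.one_div_pos_of_nat), fun x U hU hsat hxU => ?_⟩
  have hpos : ∀ a b : X, a ≠ b → 0 < ρ a b := fun a b hab => by
    obtain ⟨δ, hδ, h⟩ := hρ.exists_ball a {b}ᶜ (isClosed_singleton.isOpen_compl.mem_nhds hab)
    exact lt_of_lt_of_le hδ (not_lt.1 fun hlt => h b hlt rfl)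
  by_cases hmax : ∀ k ∈ connectedComponent x, ∃ k' ∈ connectedComponent x, k < k'
  · obtain ⟨z, hz, hxz⟩ := hmax x mem_connectedComponent
    obtain ⟨n, hn⟩ := exists_nat_one_div_lt (hpos x z hxz.ne)
    refine ⟨n, fun y hxy hJ => hsat x hxU ?_⟩
    obtain ⟨k, hk, hyk⟩ := (hJ {y | ∃ k ∈ connectedComponent x, y ≤ k}
      (Or.inr ⟨x, hmax, ⟨z, hz, hn.le⟩, rfl⟩)).1 ⟨x, mem_connectedComponent, le_rfl⟩
    exact (ordConnected_connectedComponent x).out mem_connectedComponent hk ⟨hxy, hyk⟩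
  push Not at hmax
  obtain ⟨m, hm, hmmax⟩ := hmax
  have hmx : connectedComponent m = connectedComponent x := (connectedComponent_eq hm).symm
  obtain ⟨δ, hδ, hδU⟩ := hρ.exists_ball m U (hU.mem_nhds (hsat x hxU hm))
  have hF : Disjoint (connectedComponent m) (interior {v | ρ m v < δ / 2} ∪ Iio m)ᶜ := by
    rw [disjoint_compl_right_iff_subset]
    intro k hk
    rcases (hmmax k (hmx ▸ hk)).lt_or_eq with h | rfl
    · exact Or.inr h
    · exact Or.inl (mem_interior_iff_mem_nhds.2 (hρ.ball_mem k _ (by positivity)))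
  obtain ⟨W, hW, hmW, hWF⟩ := exists_isOpen_forall_gt
    (isOpen_interior.union (isOpen_Iio' m)).isClosed_compl hF
  obtain ⟨δ', hδ', hδW⟩ := hρ.exists_ball m W (hW.mem_nhds hmW)
  obtain ⟨n, hn⟩ := exists_nat_one_div_lt (show 0 < min (δ / 2) δ' / 3 by positivity)
  have hn₁ : 3 * (1 / ((n : ℝ) + 1)) < δ / 2 := by linarith [min_le_left (δ / 2) δ']
  have hn₂ : 3 * (1 / ((n : ℝ) + 1)) < δ' := by linarith [min_le_right (δ / 2) δ']
  refine ⟨n, fun y hxy hJ => ?_⟩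
  rcases le_total y m with hym | hmy
  · exact hsat x hxU
      ((ordConnected_connectedComponent x).out mem_connectedComponent hm ⟨hxy, hym⟩)
  have hmJ : ∀ J ∈ cuts n, m ∈ J ↔ y ∈ J := fun J hJn => by
    have hJc := (hcuts n).isClopen J hJn
    rw [← hJ J (Or.inl hJn)]
    exact ⟨fun h => hJc.connectedComponent_subset h (hmx ▸ mem_connectedComponent),
      fun h => hJc.connectedComponent_subset h hm⟩
  obtain ⟨p, q, hmp, hpq, hqy, hqp, hρp, hρq⟩ := hsep n m y hmy hmJ
  have hpF : Disjoint (connectedComponent p) (interior {v | ρ m v < δ / 2} ∪ Iio m)ᶜ := by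
    rcases hmp.lt_or_eq with h | rfl
    · exact hWF p (hδW p (hρp.trans_lt hn₂)) h
    · exact hF
  have hq : ρ m q < δ / 2 := by
    rcases disjoint_compl_right_iff_subset.1 hpF hqp with h | h
    · exact interior_subset (s := {v | ρ m v < δ / 2}) h
    · exact absurd h (not_lt.2 (hmp.trans hpq))
  exact hδU y (by linarith [hρ.triangle m q y])

end ConvexDist

theorem exists_separating_seq [CompatibleOrder X] [TopologicalSpace.MetrizableSpace X] :
    ∃ 𝒥 : ℕ × ℕ → Set (Set X), (∀ n, LocallyFiniteClopen (𝒥 n)) ∧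
      ∀ x U, IsOpen U → (∀ u ∈ U, connectedComponent u ⊆ U) → x ∈ U →
        ∃ n, ∀ y, (∀ J ∈ 𝒥 n, x ∈ J ↔ y ∈ J) → y ∈ U := by
  obtain ⟨ρ, hρ⟩ := exists_convexDist (X := X)
  have : TopologicalSpace.MetrizableSpace Xᵒᵈ := ‹TopologicalSpace.MetrizableSpace X›
  obtain ⟨ρ', hρ'⟩ := exists_convexDist (X := Xᵒᵈ)
  obtain ⟨𝒥, h𝒥, hup⟩ := hρ.exists_cuts_seq
  obtain ⟨𝒥', h𝒥', hdown⟩ := hρ'.exists_cuts_seq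
  refine ⟨fun n => 𝒥 n.1 ∪ 𝒥' n.2, fun n => (h𝒥 n.1).union ⟨(h𝒥' n.2).1, (h𝒥' n.2).2⟩,
    fun x U hU hsat hxU => ?_⟩
  obtain ⟨n, hn⟩ := hup x U hU hsat hxU
  obtain ⟨n', hn'⟩ := hdown x U hU hsat hxU
  refine ⟨(n, n'), fun y hy => ?_⟩
  rcases le_total x y with h | h
  · exact hn y h fun J hJ => hy J (Or.inl hJ)
  · exact hn' y h fun J hJ => hy J (Or.inr hJ)

theorem metrizableSpace_connectedComponents [CompatibleOrder X]
    [TopologicalSpace.MetrizableSpace X] :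
    TopologicalSpace.MetrizableSpace (ConnectedComponents X) := by
  obtain ⟨𝒥, h𝒥, hsep⟩ := exists_separating_seq (X := X)
  let : TopologicalSpace (Set (Set X)) := ⊥
  have : DiscreteTopology (Set (Set X)) := ⟨rfl⟩
  let g : X → ℕ × ℕ → Set (Set X) := fun x n => {J ∈ 𝒥 n | x ∈ J}
  have hg : ∀ n x y, g x n = g y n ↔ ∀ J ∈ 𝒥 n, x ∈ J ↔ y ∈ J := fun n x y =>
    sep_ext_iff
  have hgc : Continuous g := continuous_pi fun n => by
    refine IsLocallyConstant.continuous ((IsLocallyConstant.iff_exists_open _).2 fun x => ?_)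
    exact ⟨_, (h𝒥 n).isOpen_setOf_forall_mem_iff x, fun _ _ => Iff.rfl,
      fun y hy => ((hg n x y).2 hy).symm⟩
  have hnhds : ∀ x : X, ∀ s ∈ 𝓝 (x : ConnectedComponents X),
      ∃ n, ∀ y : X, g x n = g y n → (y : ConnectedComponents X) ∈ s := fun x s hs => by
    obtain ⟨V, hVs, hV, hxV⟩ := mem_nhds_iff.1 hs
    obtain ⟨n, hn⟩ := hsep x _ (hV.preimage ConnectedComponents.continuous_coe)
      (fun u hu v hv => by
        have : (v : ConnectedComponents X) = u := ConnectedComponents.coe_eq_coe'.2 hv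
        rwa [mem_preimage, this]) hxV
    exact ⟨n, fun y hy => hVs (hn y ((hg n x y).1 hy))⟩
  have hlift : ∀ x y : X, connectedComponent x = connectedComponent y → g x = g y :=
    fun x y hxy => funext fun n => (hg n x y).2 fun J hJ => by
      have hJc := (h𝒥 n).isClopen J hJ
      exact ⟨fun h => hJc.connectedComponent_subset h (hxy ▸ mem_connectedComponent),
        fun h => hJc.connectedComponent_subset h (hxy ▸ mem_connectedComponent)⟩
  let f : ConnectedComponents X → ℕ × ℕ → Set (Set X) :=
    Quotient.lift g hlift
  have hfc : Continuous f := hgc.quotient_lift hlift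
  have hind : IsInducing f := by
    rw [isInducing_iff_nhds]
    intro z
    obtain ⟨x, rfl⟩ := ConnectedComponents.surjective_coe z
    refine le_antisymm (hfc.tendsto _).le_comap fun s hs => ?_
    obtain ⟨n, hn⟩ := hnhds x s hs
    refine Filter.mem_comap.2 ⟨{h | g x n = h n}, ?_, ?_⟩
    · exact (continuous_apply n).continuousAt.preimage_mem_nhds
        ((isOpen_discrete {b | g x n = b}).mem_nhds rfl)
    · intro w hw
      obtain ⟨y, rfl⟩ := ConnectedComponents.surjective_coe w
      exact hn y hw
  exact (IsEmbedding.mk hind hind.injective).metrizableSpace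

end Metrizable

end CompatibleOrder

/-- Theorem 3.1: for a suborderable Hausdorff space `X`, the quotient space of
connected components is strongly zero-dimensional and suborderable, the
quotient map is closed, and it is metrizable whenever `X` is. -/
theorem stmt5 {X : Type*} [TopologicalSpace X] [T2Space X]
    (hX : Suborderable X) :
    StronglyZeroDimensional (ConnectedComponents X) ∧
    Suborderable (ConnectedComponents X) ∧
    IsClosedMap (ConnectedComponents.mk : X → ConnectedComponents X) ∧
    (TopologicalSpace.MetrizableSpace X →
      TopologicalSpace.MetrizableSpace (ConnectedComponents X)) := by
  obtain ⟨l, hlt, hgt, hconv⟩ := hX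
  let := l
  have : CompatibleOrder X := ⟨hlt, hgt, fun x U hU hx => by
    obtain ⟨V, hV, hxV, hVU, hc⟩ := hconv x U hU hx
    exact ⟨V, hV, hxV, hVU, ⟨fun a ha b hb c hc' => hc a ha b hb c hc'.1 hc'.2⟩⟩⟩
  refine ⟨CompatibleOrder.stronglyZeroDimensional, ⟨inferInstance,
    CompatibleOrder.isOpen_Iio', CompatibleOrder.isOpen_Ioi', fun z U hU hz => ?_⟩,
    CompatibleOrder.isClosedMap_connectedComponents,
    fun _ => CompatibleOrder.metrizableSpace_connectedComponents⟩
  obtain ⟨V, hV, hzV, hVU, hc⟩ := CompatibleOrder.exists_ordConnected z U hU hz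
  exact ⟨V, hV, hzV, hVU, fun a ha b hb c hac hcb => hc.out ha hb ⟨hac, hcb⟩⟩
end

section
/- Let X be a metrizable suborderable Hausdorff space and let U be an open cover of X such that each connected component of X is contained in some member of U. Then U has a discrete refinement: there is a cover V of X by open sets, refining U (every member of V is contained in some member of U), such that the family V is discrete in X (every point of X has a neighbourhood meeting at most one member of V). -/
open Topology

open Set

section OpenPartition

variable {X : Type*} [TopologicalSpace X]

/-- `S` is the union of a pairwise disjoint family of open sets, each of them contained in a
member of `𝒰`. -/
def HasOpenPartition (𝒰 : Set (Set X)) (S : Set X) : Prop :=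
  ∃ 𝒱 : Set (Set X), (∀ V ∈ 𝒱, IsOpen V) ∧ (∀ V ∈ 𝒱, ∃ U ∈ 𝒰, V ⊆ U) ∧
    𝒱.PairwiseDisjoint id ∧ ⋃₀ 𝒱 = S

/-- `S` is covered by countably many clopen sets, each of them contained in a member of `𝒰`. -/
def HasCountableClopenCover (𝒰 : Set (Set X)) (S : Set X) : Prop :=
  ∃ 𝒞 : Set (Set X), 𝒞.Countable ∧ (∀ W ∈ 𝒞, IsClopen W ∧ ∃ U ∈ 𝒰, W ⊆ U) ∧ S ⊆ ⋃₀ 𝒞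

lemma HasCountableClopenCover.mono {𝒰 : Set (Set X)} {S T : Set X} (hST : S ⊆ T)
    (hT : HasCountableClopenCover 𝒰 T) : HasCountableClopenCover 𝒰 S := by
  obtain ⟨𝒞, h1, h2, h3⟩ := hT
  exact ⟨𝒞, h1, h2, hST.trans h3⟩

lemma HasCountableClopenCover.sUnion {𝒰 : Set (Set X)} {𝒮 : Set (Set X)} (h𝒮 : 𝒮.Countable)
    (h : ∀ S ∈ 𝒮, HasCountableClopenCover 𝒰 S) : HasCountableClopenCover 𝒰 (⋃₀ 𝒮) := by
  choose! 𝒞 h1 h2 h3 using h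
  refine ⟨⋃ S ∈ 𝒮, 𝒞 S, h𝒮.biUnion h1, ?_, ?_⟩
  · intro W hW
    obtain ⟨S, hS, hW⟩ := mem_iUnion₂.1 hW
    exact h2 S hS W hW
  · rintro x ⟨S, hS, hx⟩
    obtain ⟨W, hW, hxW⟩ := h3 S hS hx
    exact ⟨W, mem_iUnion₂.2 ⟨S, hS, hW⟩, hxW⟩

lemma HasOpenPartition.iUnion_nat {𝒰 : Set (Set X)} {S : ℕ → Set X} (hS : ∀ n, IsClosed (S n))
    (h : ∀ n, HasOpenPartition 𝒰 (S n)) : HasOpenPartition 𝒰 (⋃ n, S n) := by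
  choose 𝒱 hopen href hdisj hunion using h
  have hsub : ∀ n, ∀ V ∈ 𝒱 n, V ⊆ S n := fun n V hV ↦ hunion n ▸ subset_sUnion_of_mem hV
  refine ⟨{W | ∃ n, ∃ V ∈ 𝒱 n, W = V \ ⋃ k ∈ Iio n, S k}, ?_, ?_, ?_, ?_⟩
  · rintro _ ⟨n, V, hV, rfl⟩
    exact (hopen n V hV).sdiff ((finite_Iio n).isClosed_biUnion fun k _ ↦ hS k)
  · rintro _ ⟨n, V, hV, rfl⟩
    obtain ⟨U, hU, hVU⟩ := href n V hV
    exact ⟨U, hU, sdiff_subset.trans hVU⟩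
  · rintro _ ⟨n, V, hV, rfl⟩ _ ⟨m, W, hW, rfl⟩ hne
    refine disjoint_left.2 fun x hx hy ↦ ?_
    simp only [id, mem_sdiff, mem_iUnion, mem_Iio, not_exists] at hx hy
    rcases lt_trichotomy n m with hnm | rfl | hnm
    · exact hy.2 n hnm (hsub n V hV hx.1)
    · have hVW : V ≠ W := fun hVW ↦ hne (by rw [hVW])
      exact disjoint_left.1 (hdisj n hV hW hVW) hx.1 hy.1
    · exact hx.2 m hnm (hsub m W hW hy.1)
  · refine subset_antisymm ?_ fun x hx ↦ ?_
    · rintro x ⟨_, ⟨n, V, hV, rfl⟩, hx⟩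
      exact mem_iUnion.2 ⟨n, hsub n V hV hx.1⟩
    · classical
      have hex := mem_iUnion.1 hx
      have hmem := Nat.find_spec hex
      rw [← hunion] at hmem
      obtain ⟨V, hV, hxV⟩ := hmem
      refine ⟨_, ⟨_, V, hV, rfl⟩, hxV, ?_⟩
      simp only [mem_iUnion, mem_Iio, not_exists]
      exact fun k hk ↦ Nat.find_min hex hk

lemma HasOpenPartition.sUnion {𝒰 : Set (Set X)} {𝒬 : Set (Set X)}
    (hdisj : 𝒬.PairwiseDisjoint id) (h : ∀ Q ∈ 𝒬, HasOpenPartition 𝒰 Q) :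
    HasOpenPartition 𝒰 (⋃₀ 𝒬) := by
  choose! 𝒱 hopen href hdisj' hunion using h
  have hsub : ∀ Q ∈ 𝒬, ∀ V ∈ 𝒱 Q, V ⊆ Q := fun Q hQ V hV ↦
    (subset_sUnion_of_mem hV).trans (hunion Q hQ).subset
  refine ⟨⋃ Q ∈ 𝒬, 𝒱 Q, ?_, ?_, ?_, ?_⟩
  · intro V hV
    obtain ⟨Q, hQ, hV⟩ := mem_iUnion₂.1 hV
    exact hopen Q hQ V hV
  · intro V hV
    obtain ⟨Q, hQ, hV⟩ := mem_iUnion₂.1 hV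
    exact href Q hQ V hV
  · intro V hV W hW hne
    obtain ⟨Q, hQ, hV⟩ := mem_iUnion₂.1 hV
    obtain ⟨R, hR, hW⟩ := mem_iUnion₂.1 hW
    rcases eq_or_ne Q R with rfl | hQR
    · exact hdisj' Q hQ hV hW hne
    · exact (hdisj hQ hR hQR).mono (hsub Q hQ V hV) (hsub R hR W hW)
  · refine subset_antisymm ?_ ?_
    · rintro x ⟨V, hV, hx⟩
      obtain ⟨Q, hQ, hV⟩ := mem_iUnion₂.1 hV
      exact ⟨Q, hQ, hsub Q hQ V hV hx⟩
    · rintro x ⟨Q, hQ, hx⟩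
      rw [← hunion Q hQ] at hx
      obtain ⟨V, hV, hxV⟩ := hx
      exact ⟨V, mem_iUnion₂.2 ⟨Q, hQ, hV⟩, hxV⟩

lemma HasCountableClopenCover.hasOpenPartition {𝒰 : Set (Set X)} {Q : Set X} (hQ : IsClopen Q)
    (h : HasCountableClopenCover 𝒰 Q) : HasOpenPartition 𝒰 Q := by
  obtain ⟨𝒞, hc, hcl, hsub⟩ := h
  rcases 𝒞.eq_empty_or_nonempty with rfl | hne
  · rw [sUnion_empty, subset_empty_iff] at hsub
    exact ⟨∅, by simp [hsub]⟩
  obtain ⟨W, rfl⟩ := hc.exists_eq_range hne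
  have hW := fun n ↦ hcl (W n) (mem_range_self n)
  have heq : Q = ⋃ n, W n ∩ Q := by
    rw [← iUnion_inter, ← sUnion_range, inter_eq_right.2 hsub]
  rw [heq]
  refine HasOpenPartition.iUnion_nat (fun n ↦ ((hW n).1.inter hQ).1) fun n ↦
    ⟨{W n ∩ Q}, ?_, ?_, pairwiseDisjoint_singleton _ _, sUnion_singleton _⟩
  · rintro _ rfl
    exact ((hW n).1.inter hQ).2
  · rintro _ rfl
    obtain ⟨U, hU, hWU⟩ := (hW n).2
    exact ⟨U, hU, inter_subset_left.trans hWU⟩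

end OpenPartition

/-- In a metric space, an increasing sequence of locally finite sets can have dense union. -/
lemma exists_monotone_locallyFinite_dense (X : Type*) [MetricSpace X] :
    ∃ A : ℕ → Set X, Monotone A ∧ (∀ n x, ∃ N ∈ 𝓝 x, (N ∩ A n).Finite) ∧ Dense (⋃ n, A n) := by
  have hsep : ∀ n : ℕ, ∃ B : Set X,
      Maximal (· ∈ {B : Set X | B.Pairwise fun x y ↦ 1 / ((n : ℝ) + 1) ≤ dist x y}) B := by
    refine fun n ↦ zorn_subset _ fun c hc hchain ↦
      ⟨⋃₀ c, (pairwise_sUnion hchain.directedOn).2 hc, fun s hs ↦ subset_sUnion_of_mem hs⟩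
  choose B hB using hsep
  have hpos : ∀ n : ℕ, (0 : ℝ) < 1 / ((n : ℝ) + 1) := fun n ↦ Nat.one_div_pos_of_nat
  refine ⟨accumulate B, monotone_accumulate, fun n x ↦ ?_, ?_⟩
  · have hfin : ∀ k, ∃ N ∈ 𝓝 x, (N ∩ B k).Finite := by
      refine fun k ↦ ⟨_, Metric.ball_mem_nhds x (half_pos (hpos k)), Subsingleton.finite ?_⟩
      rintro y ⟨hy, hyB⟩ z ⟨hz, hzB⟩
      by_contra hne
      have h1 := (hB k).prop hyB hzB hne
      have h2 := dist_triangle_right y z x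
      rw [Metric.mem_ball] at hy hz
      linarith
    choose N hN hNfin using hfin
    refine ⟨⋂ k ∈ Iic n, N k, (Filter.biInter_mem (finite_Iic n)).2 fun k _ ↦ hN k, ?_⟩
    refine ((finite_Iic n).biUnion fun k _ ↦ hNfin k).subset ?_
    rintro y ⟨hyN, hyB⟩
    obtain ⟨k, hk, hyk⟩ := mem_accumulate.1 hyB
    exact mem_iUnion₂.2 ⟨k, hk, mem_iInter₂.1 hyN k hk, hyk⟩
  · rw [iUnion_accumulate, Metric.dense_iff]
    intro x r hr
    obtain ⟨n, hn⟩ := exists_nat_one_div_lt hr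
    by_contra hempty
    have hfar : ∀ y ∈ B n, r ≤ dist x y := by
      intro y hy
      by_contra! hlt
      exact hempty ⟨y, by rwa [Metric.mem_ball'], mem_iUnion.2 ⟨n, hy⟩⟩
    have hins : insert x (B n) ∈
        {B : Set X | B.Pairwise fun x y ↦ 1 / ((n : ℝ) + 1) ≤ dist x y} := by
      refine pairwise_insert.2 ⟨(hB n).prop, fun y hy _ ↦ ?_⟩
      rw [dist_comm y x, and_self]
      exact hn.le.trans (hfar y hy)
    have hx : x ∈ B n := (hB n).le_of_ge hins (subset_insert _ _) (mem_insert _ _)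
    have := hfar x hx
    rw [dist_self] at this
    linarith

/-- A generalized ordered space: open rays are open and every point has a neighbourhood base of
order-convex sets. -/
structure IsGOSpace (X : Type*) [LinearOrder X] [TopologicalSpace X] : Prop where
  isOpen_Iio : ∀ a : X, IsOpen (Iio a)
  isOpen_Ioi : ∀ a : X, IsOpen (Ioi a)
  exists_ordConnected : ∀ (x : X) (U : Set X), U ∈ 𝓝 x → ∃ V ∈ 𝓝 x, V ⊆ U ∧ V.OrdConnected

namespace IsGOSpace

variable {X : Type*} [LinearOrder X] [TopologicalSpace X]

lemma dual (h : IsGOSpace X) : IsGOSpace Xᵒᵈ where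
  isOpen_Iio := h.isOpen_Ioi
  isOpen_Ioi := h.isOpen_Iio
  exists_ordConnected x U hU := by
    obtain ⟨V, hV, hVU, hconv⟩ := h.exists_ordConnected (OrderDual.ofDual x) U hU
    exact ⟨V, hV, hVU, hconv.dual⟩

lemma orderClosedTopology (h : IsGOSpace X) : OrderClosedTopology X where
  isClosed_le' := by
    rw [← isOpen_compl_iff, isOpen_iff_mem_nhds]
    rintro ⟨a, b⟩ hab
    have hba : b < a := not_le.1 hab
    by_cases hmid : ∃ c, b < c ∧ c < a
    · obtain ⟨c, hbc, hca⟩ := hmid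
      filter_upwards [prod_mem_nhds ((h.isOpen_Ioi c).mem_nhds hca)
        ((h.isOpen_Iio c).mem_nhds hbc)] with p hp
      exact not_le.2 (lt_trans hp.2 hp.1)
    · filter_upwards [prod_mem_nhds ((h.isOpen_Ioi b).mem_nhds hba)
        ((h.isOpen_Iio a).mem_nhds hba)] with p hp
      exact not_le.2 (lt_of_lt_of_le hp.2 (not_lt.1 fun hlt ↦ hmid ⟨p.1, hp.1, hlt⟩))

/-- Points in different components are separated by a clopen lower set. -/
lemma exists_isClopen_isLowerSet (h : IsGOSpace X) {c t : X} (hct : c ≤ t)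
    (ht : t ∉ connectedComponent c) :
    ∃ D : Set X, IsClopen D ∧ IsLowerSet D ∧ c ∈ D ∧ t ∉ D := by
  have hnot : ¬ IsPreconnected (Icc c t) := fun hpre ↦
    ht (hpre.subset_connectedComponent (left_mem_Icc.2 hct) (right_mem_Icc.2 hct))
  obtain ⟨u, v, hu, hv, hcov, hdisj, hcu, hnu⟩ : ∃ u v : Set X, IsOpen u ∧ IsOpen v ∧
      Icc c t ⊆ u ∪ v ∧ Icc c t ∩ (u ∩ v) = ∅ ∧ c ∈ u ∧ ¬ Icc c t ⊆ u := by
    rw [isPreconnected_iff_subset_of_disjoint] at hnot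
    push Not at hnot
    obtain ⟨u, v, hu, hv, hcov, hdisj, hnu, hnv⟩ := hnot
    rcases hcov (left_mem_Icc.2 hct) with hc | hc
    · exact ⟨u, v, hu, hv, hcov, hdisj, hc, hnu⟩
    · exact ⟨v, u, hv, hu, union_comm u v ▸ hcov, inter_comm u v ▸ hdisj, hc, hnv⟩
  refine ⟨{s | Icc c s ⊆ u}, ⟨?_, ?_⟩, ?_, ?_, hnu⟩
  · rw [← isOpen_compl_iff, isOpen_iff_mem_nhds]
    intro s hs
    obtain ⟨q, ⟨hcq, hqs⟩, hqu⟩ := not_subset.1 hs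
    have key : ∀ p, p < s → ¬ Icc c p ⊆ u → {s | Icc c s ⊆ u}ᶜ ∈ 𝓝 s := by
      intro p hps hp
      filter_upwards [(h.isOpen_Ioi p).mem_nhds hps] with r hr hru
      exact hp ((Icc_subset_Icc_right (le_of_lt hr)).trans hru)
    rcases hqs.lt_or_eq with hqs | rfl
    · exact key q hqs fun hsub ↦ hqu (hsub (right_mem_Icc.2 hcq))
    rcases lt_or_ge t q with htq | hqt
    · exact key t htq hnu
    have hcq' : c < q := lt_of_le_of_ne hcq fun heq ↦ hqu (heq ▸ hcu)
    have hqv : q ∈ v := (hcov ⟨hcq, hqt⟩).resolve_left hqu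
    filter_upwards [hv.mem_nhds hqv, (h.isOpen_Ioi c).mem_nhds hcq'] with r hrv hcr hru
    rcases le_total q r with hqr | hrq
    · exact hqu (hru ⟨hcq, hqr⟩)
    · exact (hdisj ▸ notMem_empty r :)
        ⟨⟨le_of_lt hcr, hrq.trans hqt⟩, hru (right_mem_Icc.2 (le_of_lt hcr)), hrv⟩
  · rw [isOpen_iff_mem_nhds]
    intro s hs
    rcases lt_or_ge s c with hsc | hcs
    · filter_upwards [(h.isOpen_Iio c).mem_nhds hsc] with r hr
      simp [Icc_eq_empty (not_le.2 hr)]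
    · obtain ⟨V, hV, hVu, hconv⟩ :=
        h.exists_ordConnected s u (hu.mem_nhds (hs (right_mem_Icc.2 hcs)))
      filter_upwards [hV] with r hr q hq
      rcases le_total q s with hqs | hsq
      · exact hs ⟨hq.1, hqs⟩
      · exact hVu (hconv.out (mem_of_mem_nhds hV) hr ⟨hsq, hq.2⟩)
  · exact fun a b hba ha ↦ (Icc_subset_Icc_right hba).trans ha
  · simpa using hcu

lemma exists_isClopen_inter_Ici_subset (h : IsGOSpace X) {x : X} {U : Set X} (hU : IsOpen U)
    (hx : connectedComponent x ⊆ U) : ∃ D : Set X, IsClopen D ∧ x ∈ D ∧ D ∩ Ici x ⊆ U := by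
  have := h.orderClosedTopology
  have hC : (connectedComponent x).OrdConnected :=
    isPreconnected_connectedComponent.ordConnected
  have hxC : x ∈ connectedComponent x := mem_connectedComponent
  set L : Set X := {t | ∃ c ∈ connectedComponent x, t ≤ c}
  by_cases hopen : IsOpen L
  · refine ⟨L, ⟨?_, hopen⟩, ⟨x, hxC, le_rfl⟩, ?_⟩
    · rw [← isOpen_compl_iff, isOpen_iff_mem_nhds]
      intro t ht
      have htC : t ∉ connectedComponent x := fun htC ↦ ht ⟨t, htC, le_rfl⟩
      obtain ⟨V, hV, hVC, hconv⟩ := h.exists_ordConnected t (connectedComponent x)ᶜ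
        (isClosed_connectedComponent.isOpen_compl.mem_nhds htC)
      filter_upwards [hV] with s hs ⟨c, hc, hsc⟩
      have hct : c ≤ t := le_of_not_ge fun htc ↦ ht ⟨c, hc, htc⟩
      exact hVC (hconv.out hs (mem_of_mem_nhds hV) ⟨hsc, hct⟩) hc
    · rintro t ⟨⟨c, hc, htc⟩, hxt⟩
      exact hx (hC.out hxC hc ⟨hxt, htc⟩)
  · rw [isOpen_iff_mem_nhds] at hopen
    push Not at hopen
    obtain ⟨m, ⟨c, hc, hmc⟩, hm⟩ := hopen
    obtain rfl : m = c := by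
      by_contra hne
      refine hm ?_
      filter_upwards [(h.isOpen_Iio c).mem_nhds (lt_of_le_of_ne hmc hne)] with s hs
      exact ⟨c, hc, le_of_lt hs⟩
    obtain ⟨V, hV, hVU, hconv⟩ := h.exists_ordConnected m U (hU.mem_nhds (hx hc))
    obtain ⟨t, htV, htL⟩ : ∃ t ∈ V, t ∉ L :=
      not_subset.1 fun hVL ↦ hm (Filter.mem_of_superset hV hVL)
    have hlt : ∀ c ∈ connectedComponent x, c < t := fun c hc ↦ not_le.1 fun hle ↦ htL ⟨c, hc, hle⟩
    have htm : t ∉ connectedComponent m := by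
      rw [← connectedComponent_eq hc]
      exact fun ht ↦ lt_irrefl t (hlt t ht)
    obtain ⟨D, hD, hlow, hmD, htD⟩ := h.exists_isClopen_isLowerSet (hlt m hc).le htm
    have hmax : x ≤ m := by
      by_contra! hmx
      refine hm ?_
      filter_upwards [(h.isOpen_Iio x).mem_nhds hmx] with s hs
      exact ⟨x, hxC, le_of_lt hs⟩
    refine ⟨D, hD, hlow hmax hmD, ?_⟩
    rintro s ⟨hsD, hxs⟩
    rcases le_total s m with hsm | hms
    · exact hx (hC.out hxC hc ⟨hxs, hsm⟩)
    · have hst : s ≤ t := le_of_not_ge fun hts ↦ htD (hlow hts hsD)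
      exact hVU (hconv.out (mem_of_mem_nhds hV) htV ⟨hms, hst⟩)

/-- An open set containing a component contains a clopen neighbourhood of each of its points. -/
lemma exists_isClopen_subset (h : IsGOSpace X) {x : X} {U : Set X} (hU : IsOpen U)
    (hx : connectedComponent x ⊆ U) : ∃ W : Set X, IsClopen W ∧ x ∈ W ∧ W ⊆ U := by
  obtain ⟨D, hD, hxD, hDU⟩ := h.exists_isClopen_inter_Ici_subset hU hx
  obtain ⟨E, hE, hxE, hEU⟩ := h.dual.exists_isClopen_inter_Ici_subset (X := Xᵒᵈ) (x := x) hU hx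
  refine ⟨D ∩ E, IsClopen.inter hD hE, ⟨hxD, hxE⟩, ?_⟩
  rintro y ⟨hyD, hyE⟩
  rcases le_total x y with hxy | hyx
  · exact hDU ⟨hyD, hxy⟩
  · exact hEU ⟨hyE, hyx⟩

/-- Let `J` be a `σ`-ideal containing a neighbourhood of every point, and let `A` be an increasing
sequence of sets with dense union. Then for large `n` the ideal `J` contains the set of those
`y ≥ x` for which the interval from `x` to `y` is in `J` and meets `A n` in a finite set. -/
lemma exists_forall_ge_mem_ideal (h : IsGOSpace X) {J : Set X → Prop}
    (hmono : ∀ s t : Set X, s ⊆ t → J t → J s)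
    (hunion : ∀ 𝒮 : Set (Set X), 𝒮.Countable → (∀ s ∈ 𝒮, J s) → J (⋃₀ 𝒮))
    (hloc : ∀ x, ∃ N ∈ 𝓝 x, J N) {A : ℕ → Set X} (hA : Monotone A) (hdense : Dense (⋃ n, A n))
    (x : X) :
    ∃ n₀, ∀ n ≥ n₀, J {y | x ≤ y ∧ (uIcc x y ∩ A n).Finite ∧ J (uIcc x y)} := by
  set E : Set X := {y | x ≤ y ∧ J (Icc x y)}
  have hElow : ∀ y ∈ E, ∀ z, x ≤ z → z ≤ y → z ∈ E := fun y hy z hxz hzy ↦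
    ⟨hxz, hmono _ _ (Icc_subset_Icc_right hzy) hy.2⟩
  have hform : ∀ n, {y | x ≤ y ∧ (uIcc x y ∩ A n).Finite ∧ J (uIcc x y)} =
      {y ∈ E | (Icc x y ∩ A n).Finite} := by
    intro n
    ext y
    constructor
    · rintro ⟨hxy, hfin, hJ⟩
      rw [uIcc_of_le hxy] at hfin hJ
      exact ⟨⟨hxy, hJ⟩, hfin⟩
    · rintro ⟨⟨hxy, hJ⟩, hfin⟩
      rw [← uIcc_of_le hxy] at hfin hJ
      exact ⟨hxy, hfin, hJ⟩
  simp only [hform]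
  by_cases hcof : ∃ n₀, ∀ y ∈ E, ∃ a ∈ A n₀ ∩ E, y ≤ a
  · obtain ⟨n₀, hcof⟩ := hcof
    refine ⟨n₀, fun n hn ↦ ?_⟩
    set Q : Set X := {y ∈ E | (Icc x y ∩ A n).Finite}
    by_cases hbdd : ∃ a ∈ E, ∀ q ∈ Q, q ≤ a
    · obtain ⟨a, ha, hQa⟩ := hbdd
      exact hmono Q (Icc x a) (fun q hq ↦ ⟨hq.1.1, hQa q hq⟩) ha.2
    push Not at hbdd
    have hcount : (A n ∩ Q).Countable := by
      have hstrict : StrictMonoOn (fun a ↦ (Icc x a ∩ A n).ncard) (A n ∩ Q) := by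
        intro a ha b hb hab
        refine ncard_lt_ncard ?_ hb.2.2
        refine ⟨inter_subset_inter_left _ (Icc_subset_Icc_right hab.le), fun hsub ↦ ?_⟩
        exact not_le.2 hab (hsub ⟨⟨hb.2.1.1, le_rfl⟩, hb.1⟩).1.2
      exact (mapsTo_univ _ _).countable_of_injOn hstrict.injOn (to_countable univ)
    refine hmono _ _ ?_ (hunion ((fun a ↦ Icc x a) '' (A n ∩ Q)) (hcount.image _) ?_)
    · intro y hy
      obtain ⟨a, ⟨haA, haE⟩, hya⟩ := hcof y hy.1
      obtain ⟨q, hq, haq⟩ := hbdd a haE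
      refine ⟨_, mem_image_of_mem _ ⟨hA hn haA, haE, ?_⟩, hy.1.1, hya⟩
      exact hq.2.subset (inter_subset_inter_left _ (Icc_subset_Icc_right haq.le))
    · rintro _ ⟨a, ha, rfl⟩
      exact ha.2.1.2
  · push Not at hcof
    choose y hyE hy using hcof
    suffices hJE : J E from ⟨0, fun n _ ↦ hmono _ _ (fun q hq ↦ hq.1) hJE⟩
    by_contra hJE
    obtain ⟨z, hzE, hz⟩ : ∃ z ∈ E, ∀ n, y n < z := by
      by_contra! hno
      refine hJE (hmono _ _ ?_ (hunion (range fun n ↦ Icc x (y n)) (countable_range _) ?_))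
      · intro z hz
        obtain ⟨n, hn⟩ := hno z hz
        exact ⟨_, mem_range_self n, hz.1, hn⟩
      · rintro _ ⟨n, rfl⟩
        exact (hyE n).2
    obtain ⟨t, htE, hzt⟩ : ∃ t ∈ E, z < t := by
      by_contra! hno
      exact hJE (hmono E (Icc x z) (fun t ht ↦ ⟨ht.1, hno t ht⟩) hzE.2)
    obtain ⟨N, hN, hJN⟩ := hloc t
    obtain ⟨V, hV, hVN, hconv⟩ := h.exists_ordConnected t N hN
    obtain ⟨a, haA, haV, hza⟩ := hdense.inter_nhds_nonempty
      (Filter.inter_mem hV ((h.isOpen_Ioi z).mem_nhds hzt))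
    obtain ⟨n, han⟩ := mem_iUnion.1 haA
    have haE : a ∈ E := by
      refine ⟨hzE.1.trans (le_of_lt hza), ?_⟩
      refine hmono _ _ ?_ (hunion {Icc x t, N} (by simp) (by simp [htE.2, hJN]))
      intro r hr
      rcases le_total r t with hrt | htr
      · exact ⟨_, mem_insert _ _, hr.1, hrt⟩
      · exact ⟨N, by simp, hVN (hconv.out (mem_of_mem_nhds hV) haV ⟨htr, hr.2⟩)⟩
    exact absurd ((hz n).trans hza) (not_lt.2 (hy n a ⟨han, haE⟩).le)

/-- For an ideal `I` containing a neighbourhood of every point, the relation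
`uIcc x y ∈ I` is an equivalence relation with open classes. -/
lemma exists_setoid_isOpen (h : IsGOSpace X) {I : Set X → Prop}
    (hmono : ∀ s t : Set X, s ⊆ t → I t → I s) (hunion : ∀ s t : Set X, I s → I t → I (s ∪ t))
    (hloc : ∀ x, ∃ N ∈ 𝓝 x, I N) :
    ∃ r : Setoid X, (∀ x y, r x y ↔ I (uIcc x y)) ∧ ∀ x, IsOpen {y | r x y} := by
  have htrans : ∀ x y z, I (uIcc x y) → I (uIcc y z) → I (uIcc x z) := fun x y z hxy hyz ↦
    hmono _ _ uIcc_subset_uIcc_union_uIcc (hunion _ _ hxy hyz)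
  have hnear : ∀ x, ∀ᶠ y in 𝓝 x, I (uIcc x y) := by
    intro x
    obtain ⟨N, hN, hI⟩ := hloc x
    obtain ⟨V, hV, hVN, hconv⟩ := h.exists_ordConnected x N hN
    filter_upwards [hV] with y hy
    exact hmono _ _ ((hconv.uIcc_subset (mem_of_mem_nhds hV) hy).trans hVN) hI
  refine ⟨⟨fun x y ↦ I (uIcc x y), fun x ↦ (hnear x).self_of_nhds, fun {x y} hxy ↦ ?_,
    fun {x y z} ↦ htrans x y z⟩, fun x y ↦ Iff.rfl, fun x ↦ ?_⟩
  · rwa [uIcc_comm]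
  · rw [isOpen_iff_mem_nhds]
    intro y hy
    filter_upwards [hnear y] with z hz
    exact htrans x y z hy hz

end IsGOSpace

/-- The classes of an equivalence relation with open classes which satisfy a given property have
clopen union. -/
lemma Setoid.isClopen_sUnion_classes {X : Type*} [TopologicalSpace X] (r : Setoid X)
    (hr : ∀ x, IsOpen {y | r x y}) (p : Set X → Prop) :
    IsClopen (⋃₀ {Q | ∃ x, Q = {y | r x y} ∧ p Q}) := by
  constructor
  · rw [← isOpen_compl_iff, isOpen_iff_mem_nhds]
    intro x hx
    filter_upwards [(hr x).mem_nhds (r.refl x)] with y hy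
    rintro ⟨_, ⟨z, rfl, hp⟩, hzy⟩
    exact hx ⟨_, ⟨z, rfl, hp⟩, r.trans hzy (r.symm hy)⟩
  · refine isOpen_sUnion ?_
    rintro _ ⟨x, rfl, -⟩
    exact hr x

lemma IsGOSpace.hasOpenPartition_univ {X : Type*} [LinearOrder X] [MetricSpace X]
    (h : IsGOSpace X) {𝒰 : Set (Set X)} (hopen : ∀ U ∈ 𝒰, IsOpen U)
    (hcomp : ∀ x : X, ∃ U ∈ 𝒰, connectedComponent x ⊆ U) : HasOpenPartition 𝒰 univ := by
  obtain ⟨A, hA, hfin, hdense⟩ := exists_monotone_locallyFinite_dense X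
  have hmono : ∀ s t : Set X, s ⊆ t → HasCountableClopenCover 𝒰 t →
    HasCountableClopenCover 𝒰 s := fun s t ↦ HasCountableClopenCover.mono
  have hunion : ∀ 𝒮 : Set (Set X), 𝒮.Countable → (∀ s ∈ 𝒮, HasCountableClopenCover 𝒰 s) →
    HasCountableClopenCover 𝒰 (⋃₀ 𝒮) := fun 𝒮 ↦ HasCountableClopenCover.sUnion
  have hloc : ∀ x : X, ∃ N ∈ 𝓝 x, HasCountableClopenCover 𝒰 N := by
    intro x
    obtain ⟨U, hU, hxU⟩ := hcomp x
    obtain ⟨W, hW, hxW, hWU⟩ := h.exists_isClopen_subset (hopen U hU) hxU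
    refine ⟨W, hW.2.mem_nhds hxW, {W}, countable_singleton W, ?_, by simp⟩
    rintro _ rfl
    exact ⟨hW, U, hU, hWU⟩
  have hsetoid : ∀ n, ∃ r : Setoid X,
      (∀ x y, r x y ↔ (uIcc x y ∩ A n).Finite ∧ HasCountableClopenCover 𝒰 (uIcc x y)) ∧
      ∀ x, IsOpen {y | r x y} := by
    intro n
    refine h.exists_setoid_isOpen
      (I := fun s ↦ (s ∩ A n).Finite ∧ HasCountableClopenCover 𝒰 s) ?_ ?_ ?_
    · exact fun s t hst ht ↦ ⟨ht.1.subset (inter_subset_inter_left _ hst), hmono s t hst ht.2⟩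
    · intro s t hs ht
      refine ⟨union_inter_distrib_right s t _ ▸ hs.1.union ht.1, ?_⟩
      rw [← sUnion_pair]
      exact hunion _ (by simp) (by simp [hs.2, ht.2])
    · intro x
      obtain ⟨M, hM, hMfin⟩ := hfin n x
      obtain ⟨N, hN, hJN⟩ := hloc x
      exact ⟨M ∩ N, Filter.inter_mem hM hN,
        hMfin.subset (inter_subset_inter_left _ inter_subset_left),
        hmono _ _ inter_subset_right hJN⟩
  choose r hr hropen using hsetoid
  have hclass : ∀ x, ∃ n, HasCountableClopenCover 𝒰 {y | r n x y} := by
    intro x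
    obtain ⟨n, hn⟩ := h.exists_forall_ge_mem_ideal hmono hunion hloc hA hdense x
    obtain ⟨m, hm⟩ := h.dual.exists_forall_ge_mem_ideal (X := Xᵒᵈ) hmono hunion hloc hA hdense
      (OrderDual.toDual x)
    refine ⟨max n m, hmono _ _ ?_ (hunion {_, _} (by simp)
      (by
        rintro s (rfl | rfl)
        exacts [hn (max n m) (le_max_left _ _), hm (max n m) (le_max_right _ _)]))⟩
    intro y hy
    have hxy := (hr _ x y).1 hy
    rcases le_total x y with hle | hle
    · exact ⟨_, mem_insert _ _, hle, hxy⟩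
    · refine ⟨_, mem_insert_of_mem _ rfl, hle, ?_⟩
      have hdual : uIcc (OrderDual.toDual x) (OrderDual.toDual y) = uIcc x y := uIcc_toDual x y
      rw [← hdual] at hxy
      exact hxy
  have hcover : (⋃ n, ⋃₀ {Q | ∃ x, Q = {y | r n x y} ∧ HasCountableClopenCover 𝒰 Q}) = univ := by
    refine eq_univ_of_forall fun x ↦ ?_
    obtain ⟨n, hn⟩ := hclass x
    exact mem_iUnion.2 ⟨n, _, ⟨x, rfl, hn⟩, (r n).refl x⟩
  rw [← hcover]
  refine HasOpenPartition.iUnion_nat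
    (fun n ↦ ((r n).isClopen_sUnion_classes (hropen n) _).1) fun n ↦ ?_
  refine HasOpenPartition.sUnion ?_ ?_
  · rintro _ ⟨x, rfl, -⟩ _ ⟨y, rfl, -⟩ hne
    refine disjoint_left.2 fun z hxz hyz ↦ hne ?_
    have hxy : r n x y := (r n).trans hxz ((r n).symm hyz)
    ext w
    exact ⟨fun hw ↦ (r n).trans ((r n).symm hxy) hw, fun hw ↦ (r n).trans hxy hw⟩
  · rintro _ ⟨x, rfl, hQ⟩
    refine hQ.hasOpenPartition ?_
    convert (r n).isClopen_sUnion_classes (hropen n) (· = {y | r n x y}) using 1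
    ext z
    constructor
    · exact fun hz ↦ ⟨_, ⟨x, rfl, rfl⟩, hz⟩
    · rintro ⟨_, ⟨_, -, rfl⟩, hz⟩
      exact hz

/-- Corollary 3.6: if `X` is a metrizable suborderable space and `𝒰` is an open
cover such that each connected component is contained in a member of `𝒰`, then
`𝒰` has a discrete open refinement covering `X`. -/
theorem stmt10 {X : Type*} [TopologicalSpace X] [T2Space X]
    (hmet : TopologicalSpace.MetrizableSpace X) (hsub : Suborderable X)
    (𝒰 : Set (Set X)) (hopen : ∀ U ∈ 𝒰, IsOpen U) (hcov : ⋃₀ 𝒰 = Set.univ)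
    (hcomp : ∀ x : X, ∃ U ∈ 𝒰, connectedComponent x ⊆ U) :
    ∃ 𝒱 : Set (Set X), (∀ V ∈ 𝒱, IsOpen V) ∧ ⋃₀ 𝒱 = Set.univ ∧
      (∀ V ∈ 𝒱, ∃ U ∈ 𝒰, V ⊆ U) ∧
      ∀ x : X, ∃ N ∈ nhds x, {V | V ∈ 𝒱 ∧ (V ∩ N).Nonempty}.Subsingleton := by
  obtain ⟨l, hlt, hgt, hconv⟩ := hsub
  let := l
  let := TopologicalSpace.metrizableSpaceMetric X
  have h : IsGOSpace X := by
    refine ⟨hlt, hgt, fun x U hU ↦ ?_⟩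
    obtain ⟨V, hV, hxV, hVU, hVconv⟩ :=
      hconv x (interior U) isOpen_interior (mem_interior_iff_mem_nhds.2 hU)
    exact ⟨V, hV.mem_nhds hxV, hVU.trans interior_subset,
      ⟨fun a ha b hb c hc ↦ hVconv a ha b hb c hc.1 hc.2⟩⟩
  obtain ⟨𝒱, hVopen, hVref, hdisj, hVcov⟩ := h.hasOpenPartition_univ hopen hcomp
  refine ⟨𝒱, hVopen, hVcov, hVref, fun x ↦ ?_⟩
  obtain ⟨V, hV, hxV⟩ := hVcov.symm ▸ mem_univ x
  refine ⟨V, (hVopen V hV).mem_nhds hxV, ?_⟩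
  have hunique : ∀ W ∈ 𝒱, (W ∩ V).Nonempty → W = V := fun W hW hne ↦
    hdisj.eq hW hV (not_disjoint_iff_nonempty_inter.2 hne)
  rintro W ⟨hW, hWV⟩ W' ⟨hW', hWV'⟩
  rw [hunique W hW hWV, hunique W' hW' hWV']
end

section
/- Let (X,≤) be a metrizable suborderable Hausdorff space with compatible linear order ≤ and compatible convex metric ρ, having infinitely many connected components. Then for every ε > 0, each Z ∈ D[X] admits a partition U with U ⊆ D[X,ε] and |U| ≠ 2. -/
open Topology

section MetricSuborderable

variable {X : Type*} [MetricSpace X] [LinearOrder X]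

/-- `(←, C)`: the points lying strictly below every point of `C`. -/
def leftOf (C : Set X) : Set X := {x | ∀ c ∈ C, x < c}

/-- `(C, →)`: the points lying strictly above every point of `C`. -/
def rightOf (C : Set X) : Set X := {x | ∀ c ∈ C, c < x}

/-- `ℓ(C) = |cl((←, C)) ∩ C|`. -/
noncomputable def ell (C : Set X) : ℕ := (closure (leftOf C) ∩ C).ncard

/-- `r(C) = |C ∩ cl((C, →))|`. -/
noncomputable def rr (C : Set X) : ℕ := (C ∩ closure (rightOf C)).ncard

/-- The open `δ`-neighbourhood `O(C, δ)` of a set `C`. -/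
def ballAround (C : Set X) (δ : ℝ) : Set X := {x | ∃ c ∈ C, dist x c < δ}

/-- The neighbourhood `Δ(C, ε)` of a component `C`; note that
`(←, C] = (C, →)ᶜ` and `[C, →) = (←, C)ᶜ`. -/
noncomputable def Delta (C : Set X) (ε : ℝ) : Set X :=
  if ell C = 0 ∧ rr C = 0 then C
  else if ell C ≠ 0 ∧ rr C = 0 then ballAround C (ε / 2) ∩ (rightOf C)ᶜ
  else if ell C = 0 ∧ rr C ≠ 0 then ballAround C (ε / 2) ∩ (leftOf C)ᶜ
  else ballAround C (ε / 2)

/-- `D[X]`: the clopen sets that are a connected component or meet infinitely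
many connected components. -/
def DD (X : Type*) [TopologicalSpace X] : Set (Set X) :=
  {U | IsClopen U ∧ ((∃ x : X, U = connectedComponent x) ∨
    {C : Set X | ∃ x ∈ U, C = connectedComponent x}.Infinite)}

/-- `C_ε[U]`: the connected components of `U` of diameter at least `ε`. -/
noncomputable def compsGE (U : Set X) (ε : ℝ) : Set (Set X) :=
  {C | (∃ x ∈ U, C = connectedComponentIn U x) ∧
    ENNReal.ofReal ε ≤ EMetric.diam C}

/-- `D[X, ε]`: the members of `D[X]` of diameter `< ε`, or contained in
`Δ(C, ε)` for some component `C ∈ C_ε[U]`. -/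
noncomputable def DXeps (X : Type*) [MetricSpace X] [LinearOrder X] (ε : ℝ) :
    Set (Set X) :=
  {U | U ∈ DD X ∧ (EMetric.diam U < ENNReal.ofReal ε ∨
    ∃ C ∈ compsGE U ε, U ⊆ Delta C ε)}

/-- `κ[C]`: the least `n` with `diam C ≥ 2^(-n)`. -/
noncomputable def kappa (C : Set X) : ℕ :=
  sInf {n : ℕ | ENNReal.ofReal ((2 : ℝ) ^ (-(n : ℤ))) ≤ EMetric.diam C}

/-- `A < B` pointwise for subsets of a linear order. -/
def setBelow (A B : Set X) : Prop := ∀ a ∈ A, ∀ b ∈ B, a < b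

end MetricSuborderable

open Set

section Metric

variable {X : Type*} [MetricSpace X]

theorem subset_ballAround (C : Set X) {δ : ℝ} (hδ : 0 < δ) : C ⊆ ballAround C δ :=
  fun c hc => ⟨c, hc, by simpa using hδ⟩

theorem of_countable_isClopen_cover {P : Set X → Prop}
    (hsub : ∀ G H : Set X, P G → IsClopen H → H ⊆ G → P H)
    (hdisj : ∀ 𝒰 : Set (Set X), (∀ u ∈ 𝒰, P u) →
      (∀ u ∈ 𝒰, ∀ v ∈ 𝒰, u ≠ v → u ∩ v = ∅) → P (⋃₀ 𝒰))
    {𝒢 : Set (Set X)} (hc : 𝒢.Countable) (h𝒢 : ∀ G ∈ 𝒢, IsClopen G ∧ P G) {H : Set X}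
    (hH : IsClopen H) (hcov : H ⊆ ⋃₀ 𝒢) : P H := by
  rcases 𝒢.eq_empty_or_nonempty with rfl | hne
  · have hempty : P ∅ := by simpa using hdisj ∅ (by simp) (by simp)
    exact hsub _ _ hempty hH (by simpa using hcov)
  obtain ⟨G, rfl⟩ := hc.exists_eq_range hne
  have hG : ∀ n, IsClopen (G n) ∧ P (G n) := fun n => h𝒢 _ ⟨n, rfl⟩
  have hcl : ∀ n, IsClopen (disjointed G n) := fun n =>
    disjointedRec (p := IsClopen) (fun _ _ ht => ht.diff (hG _).1) (hG n).1
  have hunion : ⋃₀ (range fun n => H ∩ disjointed G n) = H := by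
    rw [sUnion_range, ← inter_iUnion, iUnion_disjointed, ← sUnion_range]
    exact inter_eq_left.2 hcov
  rw [← hunion]
  refine hdisj _ ?_ ?_
  · rintro _ ⟨n, rfl⟩
    exact hsub _ _ (hG n).2 (hH.inter (hcl n)) (inter_subset_right.trans (disjointed_subset G n))
  · rintro _ ⟨n, rfl⟩ _ ⟨k, rfl⟩ hnk
    have hnk' : n ≠ k := by rintro rfl; exact hnk rfl
    exact ((disjoint_disjointed G hnk').mono inter_subset_right inter_subset_right).inter_eq

/-- The points that can be reached from `x` by finitely many steps of length less than `δ`. -/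
def chainClass (δ : ℝ) (x : X) : Set X :=
  {z | Relation.ReflTransGen (fun a b : X => dist a b < δ) x z}

theorem mem_chainClass_self (δ : ℝ) (x : X) : x ∈ chainClass δ x := Relation.ReflTransGen.refl

theorem mem_chainClass_comm {δ : ℝ} {x y : X} : x ∈ chainClass δ y ↔ y ∈ chainClass δ x := by
  have hs : Std.Symm (fun a b : X => dist a b < δ) := ⟨fun a b hab => by rwa [dist_comm]⟩
  exact ⟨fun h => Std.Symm.symm _ _ h, fun h => Std.Symm.symm _ _ h⟩

theorem chainClass_eq_of_mem {δ : ℝ} {x y : X} (hxy : x ∈ chainClass δ y) :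
    chainClass δ x = chainClass δ y := by
  ext z
  exact ⟨fun hz => Relation.ReflTransGen.trans hxy hz,
    fun hz => Relation.ReflTransGen.trans (mem_chainClass_comm.1 hxy) hz⟩

theorem isClopen_of_chainClass_subset {δ : ℝ} (hδ : 0 < δ) {S : Set X}
    (hS : ∀ x ∈ S, chainClass δ x ⊆ S) : IsClopen S := by
  constructor
  · rw [← isOpen_compl_iff, Metric.isOpen_iff]
    refine fun x hx => ⟨δ, hδ, fun z hz hzS => hx (hS z hzS ?_)⟩
    exact Relation.ReflTransGen.single (Metric.mem_ball.1 hz)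
  · rw [Metric.isOpen_iff]
    refine fun x hx => ⟨δ, hδ, fun z hz => hS x hx ?_⟩
    exact Relation.ReflTransGen.single (by rw [dist_comm]; exact Metric.mem_ball.1 hz)

theorem isClopen_chainClass {δ : ℝ} (hδ : 0 < δ) (x : X) : IsClopen (chainClass δ x) :=
  isClopen_of_chainClass_subset hδ fun _ hy => (chainClass_eq_of_mem hy).subset

theorem connectedComponentIn_of_isClopen {U : Set X} (hU : IsClopen U) {x : X} (hx : x ∈ U) :
    connectedComponentIn U x = connectedComponent x :=
  Subset.antisymm
    (isPreconnected_connectedComponentIn.subset_connectedComponent (mem_connectedComponentIn hx))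
    (isPreconnected_connectedComponent.subset_connectedComponentIn mem_connectedComponent
      (hU.connectedComponent_subset hx))

theorem diam_ballAround_lt {ε : ℝ} {C : Set X} (hC : Metric.ediam C < ENNReal.ofReal ε) :
    ∃ δ : ℝ, 0 < δ ∧ Metric.ediam (ballAround C δ) < ENNReal.ofReal ε := by
  obtain ⟨δ, hδ, hlt⟩ := ENNReal.lt_iff_exists_add_pos_lt.1 hC
  refine ⟨(δ / 2 : NNReal), by positivity, ?_⟩
  have heq : ballAround C ((δ / 2 : NNReal) : ℝ) = Metric.thickening ((δ / 2 : NNReal) : ℝ) C := by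
    ext x
    exact Metric.mem_thickening_iff.symm
  rw [heq]
  refine (Metric.ediam_thickening_le _).trans_lt ?_
  have h2 : (2 : ENNReal) * ((δ / 2 : NNReal) : ENNReal) = δ := by
    rw [← ENNReal.coe_ofNat, ← ENNReal.coe_mul, mul_div_cancel₀ _ two_ne_zero]
  rwa [h2]

theorem exists_isClopen_split {U : Set X} (hU : IsClopen U) (hnot : ¬ IsPreconnected U) :
    ∃ A B : Set X, IsClopen A ∧ IsClopen B ∧ A.Nonempty ∧ B.Nonempty ∧ A ∪ B = U ∧ A ∩ B = ∅ := by
  rw [isPreconnected_iff_subset_of_disjoint] at hnot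
  push Not at hnot
  obtain ⟨u, v, hu, hv, huv, hdis, h1, h2⟩ := hnot
  have hnotboth : ∀ z ∈ U, z ∈ u → z ∉ v := fun z hz hzu hzv => by
    have : z ∈ U ∩ (u ∩ v) := ⟨hz, hzu, hzv⟩
    simp [hdis] at this
  have hAeq : U ∩ u = U \ v := by
    ext z
    exact ⟨fun hz => ⟨hz.1, hnotboth z hz.1 hz.2⟩,
      fun hz => ⟨hz.1, (huv hz.1).resolve_right hz.2⟩⟩
  have hBeq : U \ u = U ∩ v := by
    ext z
    exact ⟨fun hz => ⟨hz.1, (huv hz.1).resolve_left hz.2⟩,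
      fun hz => ⟨hz.1, fun hzu => hnotboth z hz.1 hzu hz.2⟩⟩
  refine ⟨U ∩ u, U \ u, ⟨by rw [hAeq]; exact hU.isClosed.sdiff hv, hU.isOpen.inter hu⟩,
    ⟨hU.isClosed.sdiff hu, by rw [hBeq]; exact hU.isOpen.inter hv⟩, ?_, ?_,
    inter_union_sdiff U u, ?_⟩
  · obtain ⟨z, hz, hzv⟩ := not_subset.1 h2
    exact ⟨z, hz, (huv hz).resolve_right hzv⟩
  · obtain ⟨z, hz, hzu⟩ := not_subset.1 h1
    exact ⟨z, hz, hzu⟩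
  · exact eq_empty_of_forall_notMem fun z hz => hz.2.2 hz.1.2

end Metric

/-- A linear order and a convex metric that make `X` a suborderable space. -/
structure IsConvexMetricOrder (X : Type*) [MetricSpace X] [LinearOrder X] : Prop where
  dist_le : ∀ x a b y : X, x ≤ a → a ≤ b → b ≤ y → dist a b ≤ dist x y
  isOpen_Iio : ∀ a : X, IsOpen (Iio a)
  isOpen_Ioi : ∀ a : X, IsOpen (Ioi a)
  exists_ordConnected : ∀ (x : X) (U : Set X), IsOpen U → x ∈ U →
    ∃ V : Set X, IsOpen V ∧ x ∈ V ∧ V ⊆ U ∧ V.OrdConnected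

/-- The reversed order on the same type. -/
abbrev reverseOrder (X : Type*) [LinearOrder X] : LinearOrder X :=
  inferInstanceAs (LinearOrder Xᵒᵈ)

namespace IsConvexMetricOrder

variable {X : Type*} [MetricSpace X] [LinearOrder X]

theorem reverse (h : IsConvexMetricOrder X) :
    @IsConvexMetricOrder X _ (reverseOrder X) :=
  @IsConvexMetricOrder.mk X _ (reverseOrder X)
    (fun x a b y hxa hab hby => by
      rw [dist_comm a b, dist_comm x y]; exact h.dist_le y b a x hby hab hxa)
    h.isOpen_Ioi h.isOpen_Iio
    (fun x U hU hx => by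
      obtain ⟨V, hV, hxV, hVU, hVc⟩ := h.exists_ordConnected x U hU hx
      refine ⟨V, hV, hxV, hVU, ?_⟩
      refine @OrdConnected.mk X (reverseOrder X).toPreorder V ?_
      intro a ha b hb z hz
      exact hVc.out hb ha ⟨hz.2, hz.1⟩)

theorem ordConnected_of_isPreconnected (h : IsConvexMetricOrder X) {C : Set X}
    (hC : IsPreconnected C) : C.OrdConnected := by
  refine ⟨fun a ha c hc b hb => ?_⟩
  by_contra hbC
  have hab : a < b := lt_of_le_of_ne hb.1 (by rintro rfl; exact hbC ha)
  have hbc : b < c := lt_of_le_of_ne hb.2 (by rintro rfl; exact hbC hc)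
  obtain ⟨z, -, hz1, hz2⟩ := hC (Iio b) (Ioi b) (h.isOpen_Iio b) (h.isOpen_Ioi b)
    (fun z hz => lt_or_gt_of_ne (by rintro rfl; exact hbC hz)) ⟨a, ha, hab⟩ ⟨c, hc, hbc⟩
  exact lt_asymm hz1 hz2

theorem trichotomy (h : IsConvexMetricOrder X) {C : Set X} (hC : IsPreconnected C) (x : X) :
    x ∈ leftOf C ∨ x ∈ C ∨ x ∈ rightOf C := by
  by_contra! hx
  obtain ⟨h1, h2, h3⟩ := hx
  simp only [leftOf, rightOf, mem_ofPred_eq, not_forall, not_lt] at h1 h3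
  obtain ⟨c, hc, hcx⟩ := h1
  obtain ⟨d, hd, hxd⟩ := h3
  exact h2 ((h.ordConnected_of_isPreconnected hC).out hc hd ⟨hcx, hxd⟩)

theorem isOpen_rightOf (h : IsConvexMetricOrder X) {C : Set X} (hC : IsPreconnected C)
    (hcl : IsClosed C) (hne : C.Nonempty) : IsOpen (rightOf C) := by
  rw [isOpen_iff_mem_nhds]
  intro x hx
  have hxC : x ∈ Cᶜ := fun hxC => lt_irrefl _ (hx x hxC)
  obtain ⟨V, hV, hxV, hVC, hVc⟩ := h.exists_ordConnected x Cᶜ hcl.isOpen_compl hxC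
  refine Filter.mem_of_superset (hV.mem_nhds hxV) fun z hz => ?_
  obtain ⟨c, hc⟩ := hne
  rcases h.trichotomy hC z with hl | hm | hr
  · exact absurd hc (hVC (hVc.out hz hxV ⟨(hl c hc).le, (hx c hc).le⟩))
  · exact absurd hm (hVC hz)
  · exact hr

theorem isOpen_leftOf (h : IsConvexMetricOrder X) {C : Set X} (hC : IsPreconnected C)
    (hcl : IsClosed C) (hne : C.Nonempty) : IsOpen (leftOf C) :=
  @isOpen_rightOf X _ (reverseOrder X) h.reverse C hC hcl hne

/-- Points in different components are separated by a clopen initial segment. -/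
theorem exists_isClopen_isLowerSet (h : IsConvexMetricOrder X) {m p : X} (hmp : m < p)
    (hp : p ∉ connectedComponent m) :
    ∃ A : Set X, IsClopen A ∧ IsLowerSet A ∧ m ∈ A ∧ p ∉ A := by
  have hnot : ¬ IsPreconnected (Icc m p) := fun hpre =>
    hp (hpre.subset_connectedComponent (left_mem_Icc.2 hmp.le) (right_mem_Icc.2 hmp.le))
  obtain ⟨u, v, hu, hv, huv, hdis, hmu, q, hq, hqu⟩ : ∃ u v : Set X, IsOpen u ∧ IsOpen v ∧
      Icc m p ⊆ u ∪ v ∧ Icc m p ∩ (u ∩ v) = ∅ ∧ m ∈ u ∧ ∃ q ∈ Icc m p, q ∉ u := by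
    rw [isPreconnected_iff_subset_of_disjoint] at hnot
    push Not at hnot
    obtain ⟨u, v, hu, hv, huv, hdis, h1, h2⟩ := hnot
    rcases huv (left_mem_Icc.2 hmp.le) with hm | hm
    · exact ⟨u, v, hu, hv, huv, hdis, hm, not_subset.1 h1⟩
    · exact ⟨v, u, hv, hu, by rwa [union_comm], by rwa [inter_comm v u], hm, not_subset.1 h2⟩
  have hdis' : ∀ z ∈ Icc m p, z ∈ v → z ∉ u := fun z hz hzv hzu => by
    have : z ∈ Icc m p ∩ (u ∩ v) := ⟨hz, hzu, hzv⟩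
    simp [hdis] at this
  refine ⟨{t | ∀ s ∈ Icc m p, s ≤ t → s ∈ u}, ⟨?_, ?_⟩, ?_, ?_, ?_⟩
  · rw [← isOpen_compl_iff, isOpen_iff_mem_nhds]
    intro t ht
    simp only [mem_compl_iff, mem_ofPred_eq, not_forall] at ht
    obtain ⟨s, hs, hst, hsu⟩ := ht
    rcases hst.lt_or_eq with hlt | rfl
    · exact Filter.mem_of_superset ((h.isOpen_Ioi s).mem_nhds hlt)
        fun z hz hzA => hsu (hzA s hs (le_of_lt hz))
    · have hsv : s ∈ v := (huv hs).resolve_left hsu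
      have hms : m < s := lt_of_le_of_ne hs.1 (by rintro rfl; exact hsu hmu)
      refine Filter.mem_of_superset ((hv.inter (h.isOpen_Ioi m)).mem_nhds ⟨hsv, hms⟩) ?_
      rintro z ⟨hzv, hmz⟩ hzA
      rcases le_total s z with hsz | hzs
      · exact hsu (hzA s hs hsz)
      · have hz : z ∈ Icc m p := ⟨le_of_lt hmz, hzs.trans hs.2⟩
        exact hdis' z hz hzv (hzA z hz le_rfl)
  · rw [isOpen_iff_mem_nhds]
    intro t ht
    rcases lt_or_ge t m with htm | hmt
    · exact Filter.mem_of_superset ((h.isOpen_Iio m).mem_nhds htm)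
        fun z hz s hs hsz => absurd (hs.1.trans hsz) (not_le.2 hz)
    · have htp : t ≤ p := by
        by_contra hpt
        exact hqu (ht q hq (hq.2.trans (not_le.1 hpt).le))
      obtain ⟨V, hV, htV, hVu, hVc⟩ := h.exists_ordConnected t u hu (ht t ⟨hmt, htp⟩ le_rfl)
      refine Filter.mem_of_superset (hV.mem_nhds htV) fun z hz s hs hsz => ?_
      rcases le_total s t with hst | hts
      · exact ht s hs hst
      · exact hVu (hVc.out htV hz ⟨hts, hsz⟩)
  · exact fun a b hba ha s hs hsb => ha s hs (hsb.trans hba)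
  · exact fun s hs hsm => by rwa [le_antisymm hsm hs.1]
  · exact fun hpA => hqu (hpA q hq hq.2)

/-- A clopen set containing a component and everything on its left, and little on its right. -/
theorem exists_isClopen_right (h : IsConvexMetricOrder X) (x : X) {δ : ℝ} (hδ : 0 < δ) :
    ∃ A : Set X, IsClopen A ∧ connectedComponent x ⊆ A ∧
      A ∩ rightOf (connectedComponent x) ⊆ ballAround (connectedComponent x) δ ∧
      (connectedComponent x ∩ closure (rightOf (connectedComponent x)) = ∅ →
        A ⊆ (rightOf (connectedComponent x))ᶜ) := by
  have hpre : IsPreconnected (connectedComponent x) := isPreconnected_connectedComponent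
  have hcl : IsClosed (connectedComponent x) := isClosed_connectedComponent
  have hne : (connectedComponent x).Nonempty := ⟨x, mem_connectedComponent⟩
  have hxR : ∀ y ∈ connectedComponent x, y ∉ rightOf (connectedComponent x) :=
    fun y hy hyR => lt_irrefl _ (hyR y hy)
  have hR := h.isOpen_rightOf hpre hcl hne
  by_cases hE : connectedComponent x ∩ closure (rightOf (connectedComponent x)) = ∅
  · refine ⟨(rightOf (connectedComponent x))ᶜ, ⟨hR.isClosed_compl, ?_⟩, hxR,
      fun z hz => absurd hz.2 hz.1, fun _ => subset_rfl⟩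
    rw [isOpen_compl_iff, ← closure_subset_iff_isClosed]
    intro y hy
    rcases h.trichotomy hpre y with hl | hm | hr
    · obtain ⟨z, hzl, hzr⟩ := mem_closure_iff.1 hy _ (h.isOpen_leftOf hpre hcl hne) hl
      obtain ⟨c, hc⟩ := hne
      exact absurd (hzl c hc) (lt_asymm (hzr c hc))
    · exact absurd (mem_inter hm hy) (by simp [hE])
    · exact hr
  · obtain ⟨m, hm, hmR⟩ := nonempty_iff_ne_empty.2 hE
    obtain ⟨p, hpR, hmp⟩ := Metric.mem_closure_iff.1 hmR δ hδ
    have hpm : p ∉ connectedComponent m := by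
      rw [← connectedComponent_eq hm]; exact fun hp => hxR p hp hpR
    obtain ⟨A, hA, hAl, hmA, hpA⟩ := h.exists_isClopen_isLowerSet (hpR m hm) hpm
    refine ⟨A, hA, hpre.subset_isClopen hA ⟨m, hm, hmA⟩, ?_, fun h0 => absurd h0 hE⟩
    rintro z ⟨hzA, hzR⟩
    have hzp : z ≤ p := by
      by_contra hpz
      exact hpA (hAl (not_le.1 hpz).le hzA)
    refine ⟨m, hm, ?_⟩
    rw [dist_comm]
    exact (h.dist_le m m z p le_rfl (hzR m hm).le hzp).trans_lt hmp

theorem exists_isClopen_left (h : IsConvexMetricOrder X) (x : X) {δ : ℝ} (hδ : 0 < δ) :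
    ∃ A : Set X, IsClopen A ∧ connectedComponent x ⊆ A ∧
      A ∩ leftOf (connectedComponent x) ⊆ ballAround (connectedComponent x) δ ∧
      (connectedComponent x ∩ closure (leftOf (connectedComponent x)) = ∅ →
        A ⊆ (leftOf (connectedComponent x))ᶜ) :=
  @exists_isClopen_right X _ (reverseOrder X) h.reverse x δ hδ

theorem inter_closure_rightOf_eq_empty (h : IsConvexMetricOrder X) {C : Set X}
    (hC : rr C = 0) : C ∩ closure (rightOf C) = ∅ := by
  have hsub : (C ∩ closure (rightOf C)).Subsingleton := by
    have key : ∀ a ∈ C ∩ closure (rightOf C), ∀ b ∈ C, ¬ a < b := by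
      rintro a ⟨-, ha⟩ b hb hab
      obtain ⟨z, hzb, hz⟩ := mem_closure_iff.1 ha _ (h.isOpen_Iio b) hab
      exact lt_asymm hzb (hz b hb)
    exact fun a ha b hb => le_antisymm (not_lt.1 (key b hb a ha.1)) (not_lt.1 (key a ha b hb.1))
  exact (ncard_eq_zero hsub.finite).1 hC

theorem inter_closure_leftOf_eq_empty (h : IsConvexMetricOrder X) {C : Set X}
    (hC : ell C = 0) : C ∩ closure (leftOf C) = ∅ := by
  rw [ell, inter_comm] at hC
  exact @inter_closure_rightOf_eq_empty X _ (reverseOrder X) h.reverse C hC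

theorem Delta_subset_ballAround (C : Set X) {ε : ℝ} (hε : 0 < ε) :
    Delta C ε ⊆ ballAround C (ε / 2) := by
  unfold Delta
  split_ifs
  · exact subset_ballAround C (half_pos hε)
  · exact inter_subset_left
  · exact inter_subset_left
  · exact subset_rfl

/-- Components have arbitrarily small clopen neighbourhoods. -/
theorem exists_isClopen_subset_Delta (h : IsConvexMetricOrder X) (x : X) {ε : ℝ} (hε : 0 < ε) :
    ∃ W : Set X, IsClopen W ∧ connectedComponent x ⊆ W ∧ W ⊆ Delta (connectedComponent x) ε := by
  obtain ⟨A, hA, hCA, hAb, hA0⟩ := h.exists_isClopen_right x (half_pos hε)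
  obtain ⟨B, hB, hCB, hBb, hB0⟩ := h.exists_isClopen_left x (half_pos hε)
  have hpre : IsPreconnected (connectedComponent x) := isPreconnected_connectedComponent
  have hb : A ∩ B ⊆ ballAround (connectedComponent x) (ε / 2) := by
    rintro z ⟨hzA, hzB⟩
    rcases h.trichotomy hpre z with hl | hm | hr
    · exact hBb ⟨hzB, hl⟩
    · exact subset_ballAround _ (half_pos hε) hm
    · exact hAb ⟨hzA, hr⟩
  have hl : ell (connectedComponent x) = 0 → B ⊆ (leftOf (connectedComponent x))ᶜ :=
    fun h0 => hB0 (h.inter_closure_leftOf_eq_empty h0)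
  have hr : rr (connectedComponent x) = 0 → A ⊆ (rightOf (connectedComponent x))ᶜ :=
    fun h0 => hA0 (h.inter_closure_rightOf_eq_empty h0)
  refine ⟨A ∩ B, hA.inter hB, subset_inter hCA hCB, ?_⟩
  unfold Delta
  split_ifs with h1 h2 h3
  · intro z hz
    rcases h.trichotomy hpre z with hz' | hz' | hz'
    · exact absurd hz' (hl h1.1 hz.2)
    · exact hz'
    · exact absurd hz' (hr h1.2 hz.1)
  · exact subset_inter hb fun z hz => hr h2.2 hz.1
  · exact subset_inter hb fun z hz => hl h3.1 hz.2
  · exact hb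

end IsConvexMetricOrder

section ClopenIdeal

variable {X : Type*} [MetricSpace X] [LinearOrder X] {P : Set X → Prop}

theorem IsConvexMetricOrder.mem_chainClass_of_le (h : IsConvexMetricOrder X) {δ : ℝ} {a b c : X}
    (hab : a ≤ b) (hbc : b ≤ c) (hc : c ∈ chainClass δ a) : b ∈ chainClass δ a := by
  induction hc with
  | refl => rw [le_antisymm hbc hab]; exact mem_chainClass_self δ a
  | @tail w c hw hwc ih =>
    rcases le_total b w with hbw | hwb
    · exact ih hbw
    · exact Relation.ReflTransGen.tail hw ((h.dist_le w w b c le_rfl hwb hbc).trans_lt hwc)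

/-- The points above `x₀` that a set of the ideal joins to `x₀` are covered by countably many
clopen sets of the ideal. -/
theorem IsConvexMetricOrder.exists_countable_cover_right (h : IsConvexMetricOrder X)
    (hsub : ∀ G H : Set X, P G → IsClopen H → H ⊆ G → P H)
    (hdisj : ∀ 𝒰 : Set (Set X), (∀ u ∈ 𝒰, P u) →
      (∀ u ∈ 𝒰, ∀ v ∈ 𝒰, u ≠ v → u ∩ v = ∅) → P (⋃₀ 𝒰)) (x₀ : X) :
    ∃ 𝒢 : Set (Set X), 𝒢.Countable ∧ (∀ G ∈ 𝒢, IsClopen G ∧ P G) ∧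
      {y | x₀ ≤ y ∧ ∃ G, IsClopen G ∧ P G ∧ Icc x₀ y ⊆ G} ⊆ ⋃₀ 𝒢 := by
  set R : Set X := {y | x₀ ≤ y ∧ ∃ G, IsClopen G ∧ P G ∧ Icc x₀ y ⊆ G} with hRdef
  choose! F hF using fun y (hy : y ∈ R) => hy.2
  by_cases hcof : ∃ S : Set X, S.Countable ∧ S ⊆ R ∧ ∀ y ∈ R, ∃ s ∈ S, y ≤ s
  · obtain ⟨S, hSc, hSR, hS⟩ := hcof
    refine ⟨F '' S, hSc.image F, ?_, fun y hy => ?_⟩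
    · rintro _ ⟨s, hs, rfl⟩
      exact ⟨(hF s (hSR hs)).1, (hF s (hSR hs)).2.1⟩
    · obtain ⟨s, hs, hys⟩ := hS y hy
      exact ⟨F s, ⟨s, hs, rfl⟩, (hF s (hSR hs)).2.2 ⟨hy.1, hys⟩⟩
  push Not at hcof
  rcases R.eq_empty_or_nonempty with hR0 | ⟨r₀, hr₀⟩
  · exact ⟨∅, countable_empty, by simp, by simp [hR0]⟩
  obtain ⟨δ, hδ, hstep⟩ : ∃ δ : ℝ, 0 < δ ∧ ∀ b ∈ R, ∃ y ∈ R, b ≤ y ∧ δ ≤ dist b y := by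
    by_contra! hno
    choose b hbR hb using fun n : ℕ => hno (1 / ((n : ℝ) + 1)) Nat.one_div_pos_of_nat
    obtain ⟨c, hcR, hc⟩ := hcof (range b) (countable_range b) (range_subset_iff.2 hbR)
    obtain ⟨d, hdR, hd⟩ := hcof {c} (countable_singleton c) (singleton_subset_iff.2 hcR)
    have hcd : c < d := hd c rfl
    obtain ⟨n, hn⟩ := exists_nat_one_div_lt (dist_pos.2 hcd.ne)
    have hbc : b n ≤ c := (hc _ ⟨n, rfl⟩).le
    exact absurd (hb n d hdR (hbc.trans hcd.le))
      (not_lt.2 (hn.le.trans (h.dist_le _ _ _ _ hbc hcd.le le_rfl)))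
  choose! g hgR hbg hgd using hstep
  have hbdd : ∀ x ∈ R, ∃ b ∈ R, ∀ z ∈ chainClass δ x, z ≤ b := by
    intro x hx
    have hit : ∀ n : ℕ, g^[n] x ∈ R := by
      intro n
      induction n with
      | zero => exact hx
      | succ n ih => rw [Function.iterate_succ_apply']; exact hgR _ ih
    obtain ⟨b, hbR, hb⟩ := hcof (range fun n => g^[n] x) (countable_range _)
      (range_subset_iff.2 hit)
    have hchain : ∀ z ∈ chainClass δ x, ∃ n : ℕ, z ≤ g^[n] x := by
      intro z hz
      induction hz with
      | refl => exact ⟨0, le_rfl⟩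
      | @tail w z _ hwz ih =>
        obtain ⟨n, hn⟩ := ih
        refine ⟨n + 1, ?_⟩
        rw [Function.iterate_succ_apply']
        by_contra hgz
        have := h.dist_le w _ _ z hn (hbg _ (hit n)) (not_le.1 hgz).le
        linarith [hgd _ (hit n)]
    refine ⟨b, hbR, fun z hz => ?_⟩
    obtain ⟨n, hn⟩ := hchain z hz
    exact hn.trans (hb _ ⟨n, rfl⟩).le
  have hx₀ : x₀ ∈ R := by
    refine ⟨le_rfl, F r₀, (hF r₀ hr₀).1, (hF r₀ hr₀).2.1, ?_⟩
    exact (Icc_subset_Icc_right hr₀.1).trans (hF r₀ hr₀).2.2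
  obtain ⟨b₀, hb₀R, hb₀⟩ := hbdd x₀ hx₀
  have hclass : ∀ y ∈ R, x₀ ∉ chainClass δ y →
      ∃ b ∈ R, chainClass δ y ⊆ Icc x₀ b := by
    intro y hy hxy
    obtain ⟨b, hbR, hb⟩ := hbdd y hy
    refine ⟨b, hbR, fun z hz => ⟨?_, hb z hz⟩⟩
    by_contra hzx
    have := h.mem_chainClass_of_le (not_le.1 hzx).le hy.1 (mem_chainClass_comm.1 hz)
    rw [chainClass_eq_of_mem hz] at this
    exact hxy this
  set 𝒦 : Set (Set X) := {K | ∃ y ∈ R, x₀ ∉ chainClass δ y ∧ K = chainClass δ y} with h𝒦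
  refine ⟨{F b₀, ⋃₀ 𝒦}, (countable_singleton _).insert _, ?_, fun y hy => ?_⟩
  · rintro G (rfl | rfl)
    · exact ⟨(hF b₀ hb₀R).1, (hF b₀ hb₀R).2.1⟩
    · refine ⟨isClopen_of_chainClass_subset hδ ?_, hdisj _ ?_ ?_⟩
      · rintro x ⟨_, hK, hxK⟩
        obtain ⟨y, -, -, rfl⟩ := id hK
        exact (chainClass_eq_of_mem hxK).subset.trans (subset_sUnion_of_mem hK)
      · rintro _ ⟨y, hy, hxy, rfl⟩
        obtain ⟨b, hbR, hb⟩ := hclass y hy hxy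
        exact hsub _ _ (hF b hbR).2.1 (isClopen_chainClass hδ y) (hb.trans (hF b hbR).2.2)
      · rintro _ ⟨y, -, -, rfl⟩ _ ⟨z, -, -, rfl⟩ hyz
        by_contra hne
        obtain ⟨t, hty, htz⟩ := nonempty_iff_ne_empty.2 hne
        exact hyz ((chainClass_eq_of_mem hty).symm.trans (chainClass_eq_of_mem htz))
  · by_cases hxy : x₀ ∈ chainClass δ y
    · exact ⟨F b₀, Or.inl rfl,
        (hF b₀ hb₀R).2.2 ⟨hy.1, hb₀ y (mem_chainClass_comm.1 hxy)⟩⟩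
    · exact ⟨⋃₀ 𝒦, Or.inr rfl, chainClass δ y, ⟨y, hy, hxy, rfl⟩, mem_chainClass_self δ y⟩

/-- A hereditary property of clopen sets that is stable under disjoint unions and holds locally
holds for the whole space. -/
theorem IsConvexMetricOrder.clopen_ideal_univ (h : IsConvexMetricOrder X)
    (hsub : ∀ G H : Set X, P G → IsClopen H → H ⊆ G → P H)
    (hdisj : ∀ 𝒰 : Set (Set X), (∀ u ∈ 𝒰, P u) →
      (∀ u ∈ 𝒰, ∀ v ∈ 𝒰, u ≠ v → u ∩ v = ∅) → P (⋃₀ 𝒰))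
    (hloc : ∀ x : X, ∃ W, IsClopen W ∧ P W ∧ x ∈ W) : P univ := by
  set E : X → Set X := fun x => {y | ∃ G, IsClopen G ∧ P G ∧ uIcc x y ⊆ G} with hE
  have hself : ∀ x, x ∈ E x := fun x => by
    obtain ⟨W, hW, hPW, hx⟩ := hloc x
    exact ⟨W, hW, hPW, by simpa using hx⟩
  have hsymm : ∀ {x y}, y ∈ E x → x ∈ E y := fun {x y} ⟨G, hG, hPG, hxy⟩ =>
    ⟨G, hG, hPG, by rwa [uIcc_comm]⟩
  have htrans : ∀ {x y z}, y ∈ E x → z ∈ E y → z ∈ E x := by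
    rintro x y z ⟨G, hG, hPG, hxy⟩ ⟨G', hG', hPG', hyz⟩
    refine ⟨G ∪ G', hG.union hG', ?_, uIcc_subset_uIcc_union_uIcc.trans (union_subset_union hxy hyz)⟩
    refine of_countable_isClopen_cover hsub hdisj (𝒢 := {G, G'})
      ((countable_singleton _).insert _) ?_ (hG.union hG') (by simp)
    rintro K (rfl | rfl)
    exacts [⟨hG, hPG⟩, ⟨hG', hPG'⟩]
  have hnhds : ∀ x, E x ∈ 𝓝 x := fun x => by
    obtain ⟨W, hW, hPW, hx⟩ := hloc x
    obtain ⟨V, hV, hxV, hVW, hVc⟩ := h.exists_ordConnected x W hW.isOpen hx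
    exact Filter.mem_of_superset (hV.mem_nhds hxV)
      fun z hz => ⟨W, hW, hPW, (hVc.uIcc_subset hxV hz).trans hVW⟩
  have hclopen : ∀ x, IsClopen (E x) := fun x => by
    constructor
    · rw [← isOpen_compl_iff, isOpen_iff_mem_nhds]
      exact fun y hy => Filter.mem_of_superset (hnhds y)
        fun z hz hzx => hy (htrans hzx (hsymm hz))
    · rw [isOpen_iff_mem_nhds]
      exact fun y hy => Filter.mem_of_superset (hnhds y) fun z hz => htrans hy hz
  have hP : ∀ x, P (E x) := fun x => by
    obtain ⟨𝒢, h𝒢c, h𝒢, hcov⟩ := h.exists_countable_cover_right hsub hdisj x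
    obtain ⟨ℋ, hℋc, hℋ, hcov'⟩ := @exists_countable_cover_right X _ (reverseOrder X) P
      h.reverse hsub hdisj x
    refine of_countable_isClopen_cover hsub hdisj (h𝒢c.union hℋc) ?_ (hclopen x) ?_
    · rintro G (hG | hG)
      exacts [h𝒢 G hG, hℋ G hG]
    · rintro y ⟨G, hG, hPG, hxy⟩
      rw [sUnion_union]
      rcases le_total x y with hle | hle
      · rw [uIcc_of_le hle] at hxy
        exact Or.inl (hcov ⟨hle, G, hG, hPG, hxy⟩)
      · rw [uIcc_of_ge hle] at hxy
        exact Or.inr (hcov' ⟨hle, G, hG, hPG, fun z hz => hxy ⟨hz.2, hz.1⟩⟩)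
  have hun : ⋃₀ range E = univ := eq_univ_of_forall fun x => ⟨E x, ⟨x, rfl⟩, hself x⟩
  rw [← hun]
  refine hdisj _ (by rintro _ ⟨x, rfl⟩; exact hP x) ?_
  rintro _ ⟨x, rfl⟩ _ ⟨y, rfl⟩ hxy
  by_contra hne
  obtain ⟨t, htx, hty⟩ := nonempty_iff_ne_empty.2 hne
  refine hxy (Subset.antisymm (fun z hz => ?_) fun z hz => ?_)
  · exact htrans hty (htrans (hsymm htx) hz)
  · exact htrans htx (htrans (hsymm hty) hz)

end ClopenIdeal

section Partition

variable {X : Type*} [MetricSpace X] [LinearOrder X]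

/-- `G` has a partition into members of `D[X, ε]`. -/
def HasPartition (ε : ℝ) (G : Set X) : Prop :=
  ∃ 𝒰 : Set (Set X), (∀ u ∈ 𝒰, u ∈ DXeps X ε) ∧ ⋃₀ 𝒰 = G ∧
    ∀ u ∈ 𝒰, ∀ v ∈ 𝒰, u ≠ v → u ∩ v = ∅

theorem hasPartition_sUnion {ε : ℝ} (𝒰 : Set (Set X)) (h𝒰 : ∀ u ∈ 𝒰, HasPartition ε u)
    (hdisj : ∀ u ∈ 𝒰, ∀ v ∈ 𝒰, u ≠ v → u ∩ v = ∅) : HasPartition ε (⋃₀ 𝒰) := by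
  choose! F hF hFu hFd using h𝒰
  refine ⟨⋃ u ∈ 𝒰, F u, ?_, ?_, ?_⟩
  · intro w hw
    obtain ⟨u, hu, hwu⟩ := mem_iUnion₂.1 hw
    exact hF u hu w hwu
  · ext x
    constructor
    · rintro ⟨w, hw, hxw⟩
      obtain ⟨u, hu, hwu⟩ := mem_iUnion₂.1 hw
      exact ⟨u, hu, by rw [← hFu u hu]; exact ⟨w, hwu, hxw⟩⟩
    · rintro ⟨u, hu, hxu⟩
      rw [← hFu u hu] at hxu
      obtain ⟨w, hwu, hxw⟩ := hxu
      exact ⟨w, mem_iUnion₂.2 ⟨u, hu, hwu⟩, hxw⟩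
  · intro w hw w' hw' hne
    obtain ⟨u, hu, hwu⟩ := mem_iUnion₂.1 hw
    obtain ⟨v, hv, hwv⟩ := mem_iUnion₂.1 hw'
    by_cases huv : u = v
    · subst huv
      exact hFd u hu w hwu w' hwv hne
    · have h1 : w ⊆ u := by rw [← hFu u hu]; exact subset_sUnion_of_mem hwu
      have h2 : w' ⊆ v := by rw [← hFu v hv]; exact subset_sUnion_of_mem hwv
      exact subset_empty_iff.1 ((inter_subset_inter h1 h2).trans (hdisj u hu v hv huv).subset)

theorem hasPartition_of_mem {ε : ℝ} {U : Set X} (hU : U ∈ DXeps X ε) : HasPartition ε U :=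
  ⟨{U}, by simpa using hU, by simp, by
    rintro u rfl v rfl huv
    exact absurd rfl huv⟩

theorem hasPartition_union {ε : ℝ} {A B : Set X} (hA : HasPartition ε A)
    (hB : HasPartition ε B) (hAB : A ∩ B = ∅) : HasPartition ε (A ∪ B) := by
  rw [← sUnion_pair]
  refine hasPartition_sUnion _ ?_ ?_
  · rintro u (rfl | rfl)
    exacts [hA, hB]
  · rintro u (rfl | rfl) v (rfl | rfl) huv
    exacts [absurd rfl huv, hAB, by rwa [inter_comm], absurd rfl huv]

theorem subset_Delta (C : Set X) {ε : ℝ} (hε : 0 < ε) : C ⊆ Delta C ε := by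
  have hb := subset_ballAround C (half_pos hε)
  unfold Delta
  split_ifs
  · exact subset_rfl
  · exact subset_inter hb fun x hx hxR => lt_irrefl _ (hxR x hx)
  · exact subset_inter hb fun x hx hxL => lt_irrefl _ (hxL x hx)
  · exact hb

theorem connectedComponent_mem_DXeps {ε : ℝ} (hε : 0 < ε) {x : X}
    (hx : IsClopen (connectedComponent x)) : connectedComponent x ∈ DXeps X ε := by
  refine ⟨⟨hx, Or.inl ⟨x, rfl⟩⟩, ?_⟩
  rcases lt_or_ge (Metric.ediam (connectedComponent x)) (ENNReal.ofReal ε) with hd | hd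
  · exact Or.inl hd
  · exact Or.inr ⟨connectedComponent x, ⟨⟨x, mem_connectedComponent,
      (connectedComponentIn_of_isClopen hx mem_connectedComponent).symm⟩, hd⟩, subset_Delta _ hε⟩

/-- A clopen set meeting only finitely many components is partitioned by them. -/
theorem hasPartition_of_finite {ε : ℝ} (hε : 0 < ε) {H : Set X} (hH : IsClopen H)
    (hfin : {C : Set X | ∃ x ∈ H, C = connectedComponent x}.Finite) : HasPartition ε H := by
  refine ⟨{C : Set X | ∃ x ∈ H, C = connectedComponent x}, ?_, ?_, ?_⟩
  · rintro _ ⟨x, hx, rfl⟩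
    refine connectedComponent_mem_DXeps hε ⟨isClosed_connectedComponent, ?_⟩
    have heq : connectedComponent x =
        H \ ⋃₀ ({C : Set X | ∃ x ∈ H, C = connectedComponent x} \ {connectedComponent x}) := by
      ext z
      constructor
      · refine fun hz => ⟨hH.connectedComponent_subset hx hz, ?_⟩
        rintro ⟨_, ⟨⟨y, -, rfl⟩, hne⟩, hzy⟩
        exact hne ((connectedComponent_eq hzy).trans (connectedComponent_eq hz).symm)
      · rintro ⟨hzH, hz⟩
        by_contra hzx
        refine hz ⟨connectedComponent z, ⟨⟨z, hzH, rfl⟩, fun heq => hzx ?_⟩,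
          mem_connectedComponent⟩
        rw [← mem_singleton_iff.1 heq]
        exact mem_connectedComponent
    rw [heq]
    rw [sUnion_eq_biUnion]
    refine hH.isOpen.sdiff ((hfin.subset sdiff_subset).isClosed_biUnion ?_)
    rintro _ ⟨⟨y, -, rfl⟩, -⟩
    exact isClosed_connectedComponent
  · ext z
    constructor
    · rintro ⟨_, ⟨x, hx, rfl⟩, hz⟩
      exact hH.connectedComponent_subset hx hz
    · exact fun hz => ⟨_, ⟨z, hz, rfl⟩, mem_connectedComponent⟩
  · rintro _ ⟨x, -, rfl⟩ _ ⟨y, -, rfl⟩ hne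
    exact (connectedComponent_disjoint hne).inter_eq

theorem hasPartition_of_isClopen {ε : ℝ} (hε : 0 < ε) {H : Set X} (hH : IsClopen H)
    (hsmall : Metric.ediam H < ENNReal.ofReal ε ∨ ∃ C ∈ compsGE H ε, H ⊆ Delta C ε) :
    HasPartition ε H := by
  by_cases hfin : {C : Set X | ∃ x ∈ H, C = connectedComponent x}.Finite
  · exact hasPartition_of_finite hε hH hfin
  · exact hasPartition_of_mem ⟨⟨hH, Or.inr hfin⟩, hsmall⟩

theorem diam_inter_rightOf_lt
    (h : IsConvexMetricOrder X) {ε : ℝ} (hε : 0 < ε) {C H : Set X}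
    (hHC : H ⊆ ballAround C (ε / 2)) : Metric.ediam (H ∩ rightOf C) < ENNReal.ofReal ε := by
  have key : ∀ x ∈ H ∩ rightOf C, ∀ y ∈ H ∩ rightOf C, x ≤ y → dist x y ≤ ε / 2 := by
    rintro x ⟨-, hx⟩ y ⟨hyH, -⟩ hxy
    obtain ⟨c, hc, hyc⟩ := hHC hyH
    rw [dist_comm] at hyc
    exact (h.dist_le c x y y (hx c hc).le hxy le_rfl).trans hyc.le
  refine lt_of_le_of_lt (Metric.ediam_le (d := ENNReal.ofReal (ε / 2)) fun x hx y hy => ?_)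
    ((ENNReal.ofReal_lt_ofReal_iff hε).2 (half_lt_self hε))
  rw [edist_dist]
  refine ENNReal.ofReal_le_ofReal ?_
  rcases le_total x y with hxy | hxy
  · exact key x hx y hy hxy
  · rw [dist_comm]; exact key y hy x hx hxy

theorem diam_inter_leftOf_lt
    (h : IsConvexMetricOrder X) {ε : ℝ} (hε : 0 < ε) {C H : Set X}
    (hHC : H ⊆ ballAround C (ε / 2)) : Metric.ediam (H ∩ leftOf C) < ENNReal.ofReal ε :=
  @diam_inter_rightOf_lt X _ (reverseOrder X) h.reverse ε hε C H hHC

theorem hasPartition_of_subset_mem_DXeps (h : IsConvexMetricOrder X) {ε : ℝ} (hε : 0 < ε)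
    {U H : Set X} (hU : U ∈ DXeps X ε) (hH : IsClopen H) (hHU : H ⊆ U) : HasPartition ε H := by
  obtain ⟨⟨hUc, -⟩, hd | ⟨C, ⟨⟨x, hxU, rfl⟩, hCd⟩, hUC⟩⟩ := hU
  · exact hasPartition_of_isClopen hε hH (Or.inl ((Metric.ediam_mono hHU).trans_lt hd))
  rw [connectedComponentIn_of_isClopen hUc hxU] at hCd hUC
  have hpre : IsPreconnected (connectedComponent x) := isPreconnected_connectedComponent
  have hcl : IsClosed (connectedComponent x) := isClosed_connectedComponent
  have hne : (connectedComponent x).Nonempty := ⟨x, mem_connectedComponent⟩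
  by_cases hmeet : (connectedComponent x ∩ H).Nonempty
  · have hxH : x ∈ H := hpre.subset_isClopen hH hmeet mem_connectedComponent
    exact hasPartition_of_isClopen hε hH (Or.inr ⟨connectedComponent x,
      ⟨⟨x, hxH, (connectedComponentIn_of_isClopen hH hxH).symm⟩, hCd⟩, hHU.trans hUC⟩)
  have hHC : ∀ z ∈ H, z ∉ connectedComponent x := fun z hz hzC => hmeet ⟨z, hzC, hz⟩
  have hball : H ⊆ ballAround (connectedComponent x) (ε / 2) :=
    (hHU.trans hUC).trans (IsConvexMetricOrder.Delta_subset_ballAround _ hε)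
  have hlr : ∀ z ∈ leftOf (connectedComponent x), z ∉ rightOf (connectedComponent x) :=
    fun z hzl hzr => lt_asymm (hzl x mem_connectedComponent) (hzr x mem_connectedComponent)
  have hL := h.isOpen_leftOf hpre hcl hne
  have hR := h.isOpen_rightOf hpre hcl hne
  have hLeq : H ∩ leftOf (connectedComponent x) = H \ rightOf (connectedComponent x) := by
    ext z
    refine ⟨fun hz => ⟨hz.1, hlr z hz.2⟩, fun hz => ⟨hz.1, ?_⟩⟩
    exact ((h.trichotomy hpre z).resolve_right fun h' => h'.elim (hHC z hz.1) hz.2)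
  have hReq : H ∩ rightOf (connectedComponent x) = H \ leftOf (connectedComponent x) := by
    ext z
    refine ⟨fun hz => ⟨hz.1, fun hl => hlr z hl hz.2⟩, fun hz => ⟨hz.1, ?_⟩⟩
    exact ((h.trichotomy hpre z).resolve_left hz.2).resolve_left (hHC z hz.1)
  have hLc : IsClopen (H ∩ leftOf (connectedComponent x)) :=
    ⟨by rw [hLeq]; exact hH.isClosed.sdiff hR, hH.isOpen.inter hL⟩
  have hRc : IsClopen (H ∩ rightOf (connectedComponent x)) :=
    ⟨by rw [hReq]; exact hH.isClosed.sdiff hL, hH.isOpen.inter hR⟩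
  have hunion : H ∩ leftOf (connectedComponent x) ∪ H ∩ rightOf (connectedComponent x) = H := by
    rw [hLeq, sdiff_union_inter]
  rw [← hunion]
  refine hasPartition_union
    (hasPartition_of_isClopen hε hLc (Or.inl (diam_inter_leftOf_lt h hε hball)))
    (hasPartition_of_isClopen hε hRc (Or.inl (diam_inter_rightOf_lt h hε hball))) ?_
  exact eq_empty_of_forall_notMem fun z hz => hlr z hz.1.2 hz.2.2

theorem HasPartition.of_subset (h : IsConvexMetricOrder X) {ε : ℝ} (hε : 0 < ε)
    {G H : Set X} (hG : HasPartition ε G) (hH : IsClopen H) (hHG : H ⊆ G) :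
    HasPartition ε H := by
  obtain ⟨𝒰, h𝒰, rfl, hdisj⟩ := hG
  have hunion : ⋃₀ ((fun u => H ∩ u) '' 𝒰) = H := by
    rw [sUnion_image, ← inter_iUnion₂, ← sUnion_eq_biUnion]
    exact inter_eq_left.2 hHG
  rw [← hunion]
  refine hasPartition_sUnion _ ?_ ?_
  · rintro _ ⟨u, hu, rfl⟩
    exact hasPartition_of_subset_mem_DXeps h hε (h𝒰 u hu) (hH.inter (h𝒰 u hu).1.1)
      inter_subset_right
  · rintro _ ⟨u, hu, rfl⟩ _ ⟨v, hv, rfl⟩ huv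
    have huv' : u ≠ v := by rintro rfl; exact huv rfl
    exact subset_empty_iff.1 ((inter_subset_inter inter_subset_right inter_subset_right).trans
      (hdisj u hu v hv huv').subset)

theorem exists_isClopen_hasPartition (h : IsConvexMetricOrder X) {ε : ℝ} (hε : 0 < ε) (x : X) :
    ∃ W, IsClopen W ∧ HasPartition ε W ∧ x ∈ W := by
  rcases lt_or_ge (Metric.ediam (connectedComponent x)) (ENNReal.ofReal ε) with hd | hd
  · obtain ⟨δ, hδ, hlt⟩ := diam_ballAround_lt hd
    obtain ⟨W, hW, hCW, hWD⟩ := h.exists_isClopen_subset_Delta x (mul_pos two_pos hδ)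
    have hWb := hWD.trans
      (IsConvexMetricOrder.Delta_subset_ballAround (connectedComponent x) (mul_pos two_pos hδ))
    rw [mul_div_cancel_left₀ _ two_ne_zero] at hWb
    exact ⟨W, hW, hasPartition_of_isClopen hε hW (Or.inl ((Metric.ediam_mono hWb).trans_lt hlt)),
      hCW mem_connectedComponent⟩
  · obtain ⟨W, hW, hCW, hWD⟩ := h.exists_isClopen_subset_Delta x hε
    have hxW : x ∈ W := hCW mem_connectedComponent
    exact ⟨W, hW, hasPartition_of_isClopen hε hW (Or.inr ⟨connectedComponent x,
      ⟨⟨x, hxW, (connectedComponentIn_of_isClopen hW hxW).symm⟩, hd⟩, hWD⟩), hxW⟩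

theorem hasPartition_of_isClopen_set (h : IsConvexMetricOrder X) {ε : ℝ} (hε : 0 < ε) {Z : Set X}
    (hZ : IsClopen Z) : HasPartition ε Z :=
  (h.clopen_ideal_univ (P := HasPartition ε) (fun _ _ hG hH hHG => hG.of_subset h hε hH hHG)
    hasPartition_sUnion (exists_isClopen_hasPartition h hε)).of_subset h hε hZ (subset_univ Z)

/-- If a set splits into three nonempty clopen pieces, then it has a partition into members of
`D[X, ε]` which does not have exactly two members. -/
theorem exists_partition_encard_ne_two (h : IsConvexMetricOrder X) {ε : ℝ} (hε : 0 < ε)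
    {A B C : Set X} (hA : IsClopen A) (hB : IsClopen B) (hC : IsClopen C) (hAne : A.Nonempty)
    (hBne : B.Nonempty) (hCne : C.Nonempty) (hAB : A ∩ B = ∅) (hAC : A ∩ C = ∅)
    (hBC : B ∩ C = ∅) :
    ∃ 𝒰 : Set (Set X), (∀ u ∈ 𝒰, u ∈ DXeps X ε) ∧ ⋃₀ 𝒰 = A ∪ B ∪ C ∧
      (∀ u ∈ 𝒰, ∀ v ∈ 𝒰, u ≠ v → u ∩ v = ∅) ∧ 𝒰.encard ≠ 2 := by
  choose! F hF hFu hFd using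
    fun (U : Set X) (hU : IsClopen U) => hasPartition_of_isClopen_set h hε hU
  have hpiece : ∀ U : Set X, IsClopen U → ∀ w ∈ F U, w ⊆ U := fun U hU w hw => by
    rw [← hFu U hU]; exact subset_sUnion_of_mem hw
  have hcross : ∀ U V : Set X, IsClopen U → IsClopen V → U ∩ V = ∅ →
      ∀ u ∈ F U, ∀ v ∈ F V, u ∩ v = ∅ := fun U V hU hV hUV u hu v hv =>
    subset_empty_iff.1 ((inter_subset_inter (hpiece U hU u hu) (hpiece V hV v hv)).trans hUV.subset)
  have hpoint : ∀ U : Set X, IsClopen U → U.Nonempty → ∃ w ∈ F U, w.Nonempty := by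
    rintro U hU ⟨z, hz⟩
    rw [← hFu U hU] at hz
    obtain ⟨w, hw, hzw⟩ := hz
    exact ⟨w, hw, z, hzw⟩
  obtain ⟨a, haF, ha⟩ := hpoint A hA hAne
  obtain ⟨b, hbF, hb⟩ := hpoint B hB hBne
  obtain ⟨c, hcF, -⟩ := hpoint C hC hCne
  have hdist : ∀ {u v : Set X}, u.Nonempty → u ∩ v = ∅ → u ≠ v := by
    rintro u _ hu huv rfl
    rw [inter_self] at huv
    exact hu.ne_empty huv
  refine ⟨F A ∪ F B ∪ F C, ?_, ?_, ?_, ?_⟩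
  · rintro u ((hu | hu) | hu)
    exacts [hF A hA u hu, hF B hB u hu, hF C hC u hu]
  · rw [sUnion_union, sUnion_union, hFu A hA, hFu B hB, hFu C hC]
  · rintro u ((hu | hu) | hu) v ((hv | hv) | hv) huv
    · exact hFd A hA u hu v hv huv
    · exact hcross A B hA hB hAB u hu v hv
    · exact hcross A C hA hC hAC u hu v hv
    · rw [inter_comm]; exact hcross A B hA hB hAB v hv u hu
    · exact hFd B hB u hu v hv huv
    · exact hcross B C hB hC hBC u hu v hv
    · rw [inter_comm]; exact hcross A C hA hC hAC v hv u hu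
    · rw [inter_comm]; exact hcross B C hB hC hBC v hv u hu
    · exact hFd C hC u hu v hv huv
  · have hsub : ({a, b, c} : Set (Set X)) ⊆ F A ∪ F B ∪ F C := by
      rintro u (rfl | rfl | rfl)
      exacts [Or.inl (Or.inl haF), Or.inl (Or.inr hbF), Or.inr hcF]
    have h3 : ({a, b, c} : Set (Set X)).encard = 3 :=
      encard_eq_three.2 ⟨a, b, c, hdist ha (hcross A B hA hB hAB a haF b hbF),
        hdist ha (hcross A C hA hC hAC a haF c hcF),
        hdist hb (hcross B C hB hC hBC b hbF c hcF), rfl⟩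
    intro h2
    have hle := encard_le_encard hsub
    rw [h2, h3] at hle
    exact absurd hle (by decide)

end Partition

/-- Lemma 4.4: in a metrizable suborderable space `(X, ≤)` with compatible
convex metric and infinitely many connected components, for every `ε > 0`,
every `Z ∈ D[X]` admits a partition `𝒰 ⊆ D[X, ε]` with `|𝒰| ≠ 2`. -/
theorem stmt14 {X : Type*} [MetricSpace X] [LinearOrder X]
    (hconv : ∀ x a b y : X, x ≤ a → a ≤ b → b ≤ y → dist a b ≤ dist x y)
    (hIio : ∀ a : X, IsOpen (Set.Iio a)) (hIoi : ∀ a : X, IsOpen (Set.Ioi a))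
    (hbase : ∀ (x : X) (U : Set X), IsOpen U → x ∈ U →
      ∃ V : Set X, IsOpen V ∧ x ∈ V ∧ V ⊆ U ∧ V.OrdConnected)
    (hinf : (Set.range fun x : X => connectedComponent x).Infinite)
    (ε : ℝ) (hε : 0 < ε) (Z : Set X) (hZ : Z ∈ DD X) :
    ∃ 𝒰 : Set (Set X), (∀ u ∈ 𝒰, u ∈ DXeps X ε) ∧ ⋃₀ 𝒰 = Z ∧
      (∀ u ∈ 𝒰, ∀ v ∈ 𝒰, u ≠ v → u ∩ v = ∅) ∧ 𝒰.encard ≠ 2 := by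
  have h : IsConvexMetricOrder X := ⟨hconv, hIio, hIoi, hbase⟩
  obtain ⟨hZc, ⟨x, rfl⟩ | hZinf⟩ := hZ
  · refine ⟨{connectedComponent x}, ?_, sUnion_singleton _, ?_, ?_⟩
    · rintro u rfl
      exact connectedComponent_mem_DXeps hε hZc
    · rintro u rfl v rfl huv
      exact absurd rfl huv
    · rw [encard_singleton]
      decide
  have hcomp : ∀ U : Set X, IsClopen U → IsPreconnected U → ∀ x ∈ U, connectedComponent x = U :=
    fun U hU hpre x hx =>
      Subset.antisymm (hU.connectedComponent_subset hx) (hpre.subset_connectedComponent hx)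
  have hZnot : ¬ IsPreconnected Z := by
    refine fun hpre => hZinf ((finite_singleton Z).subset ?_)
    rintro _ ⟨x, hx, rfl⟩
    exact hcomp Z hZc hpre x hx
  obtain ⟨A, B, hA, hB, hAne, hBne, rfl, hAB⟩ := exists_isClopen_split hZc hZnot
  by_cases hApre : IsPreconnected A
  · have hBnot : ¬ IsPreconnected B := by
      refine fun hBpre => hZinf (((finite_singleton B).insert A).subset ?_)
      rintro _ ⟨x, hx | hx, rfl⟩
      · exact Or.inl (hcomp A hA hApre x hx)
      · exact Or.inr (hcomp B hB hBpre x hx)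
    obtain ⟨D, E, hD, hE, hDne, hEne, rfl, hDE⟩ := exists_isClopen_split hB hBnot
    rw [inter_union_distrib_left, union_empty_iff] at hAB
    rw [← union_assoc]
    exact exists_partition_encard_ne_two h hε hA hD hE hAne hDne hEne hAB.1 hAB.2 hDE
  · obtain ⟨D, E, hD, hE, hDne, hEne, rfl, hDE⟩ := exists_isClopen_split hA hApre
    rw [union_inter_distrib_right, union_empty_iff] at hAB
    exact exists_partition_encard_ne_two h hε hD hE hB hDne hEne hBne hDE hAB.1 hAB.2
end
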